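/- Let R and S be connected graphs, each of order at least 3 and not isomorphic to P3. Then every 2-connected R-free and S-free graph is hamiltonian if and only if, up to interchanging R and S, R is isomorphic to the claw K_{1,3} and S is isomorphic to one of P4, P5, P6, C3, Z1, Z2, B (the bull), N (the net), or W (the wounded). -/

import Mathlib

/-- A graph is 2-connected if it has at least 3 vertices and deleting any
single vertex leaves a connected graph. -/
def TwoConnected {V : Type*} [Fintype V] (G : SimpleGraph V) : Prop :=
  3 ≤ Fintype.card V ∧ ∀ v : V, (G.induce ({v}ᶜ : Set V)).Connected

/-- The claw `K_{1,3}`: center `0`, leaves `1, 2, 3`. -/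
def clawGraph : SimpleGraph (Fin 4) :=
  SimpleGraph.fromEdgeSet {s(0,1), s(0,2), s(0,3)}

/-- The triangle `C₃`. -/
def triangleGraph : SimpleGraph (Fin 3) :=
  SimpleGraph.fromEdgeSet {s(0,1), s(1,2), s(0,2)}

/-- `Z₁`: a triangle `0 1 2` with a pendant edge `2 3`. -/
def Z1 : SimpleGraph (Fin 4) :=
  SimpleGraph.fromEdgeSet {s(0,1), s(0,2), s(1,2), s(2,3)}

/-- `Z₂`: a triangle `0 1 2` with a pendant path `2 3 4` of length 2. -/
def Z2 : SimpleGraph (Fin 5) :=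
  SimpleGraph.fromEdgeSet {s(0,1), s(0,2), s(1,2), s(2,3), s(3,4)}

/-- The bull `B`: a triangle `0 1 2` with pendant edges `0 3` and `1 4`. -/
def bullGraph : SimpleGraph (Fin 5) :=
  SimpleGraph.fromEdgeSet {s(0,1), s(0,2), s(1,2), s(0,3), s(1,4)}

/-- The net `N`: a triangle `0 1 2` with pendant edges `0 3`, `1 4` and `2 5`. -/
def netGraph : SimpleGraph (Fin 6) :=
  SimpleGraph.fromEdgeSet {s(0,1), s(0,2), s(1,2), s(0,3), s(1,4), s(2,5)}

/-- The wounded `W`: a triangle `0 1 2` with a pendant edge `0 3` and a pendant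
path `1 4 5` of length 2. -/
def woundedGraph : SimpleGraph (Fin 6) :=
  SimpleGraph.fromEdgeSet {s(0,1), s(0,2), s(1,2), s(0,3), s(1,4), s(4,5)}

/-- `G` contains no induced subgraph isomorphic to `H`. -/
def IndFree {α β : Type*} (G : SimpleGraph α) (H : SimpleGraph β) : Prop :=
  ¬ ∃ s : Set α, Nonempty (H ≃g G.induce s)

/-- `X` is isomorphic to one of `P₄, P₅, P₆, C₃, Z₁, Z₂, B, N, W`. -/
def IsOneOfBedrossian {χ : Type*} (X : SimpleGraph χ) : Prop :=
  Nonempty (X ≃g SimpleGraph.pathGraph 4) ∨ Nonempty (X ≃g SimpleGraph.pathGraph 5) ∨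
  Nonempty (X ≃g SimpleGraph.pathGraph 6) ∨ Nonempty (X ≃g triangleGraph) ∨
  Nonempty (X ≃g Z1) ∨ Nonempty (X ≃g Z2) ∨ Nonempty (X ≃g bullGraph) ∨
  Nonempty (X ≃g netGraph) ∨ Nonempty (X ≃g woundedGraph)

namespace Bedrossian

variable {V : Type*} {G : SimpleGraph V}

/-- `l` is the list of inner vertices of a walk from `x` to `y`. -/
def Link (G : SimpleGraph V) (x : V) (l : List V) (y : V) : Prop :=
  List.IsChain G.Adj (x :: (l ++ [y]))

theorem link_nil {x y : V} : Link G x [] y ↔ G.Adj x y := by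
  simp [Link]

theorem link_cons {x y z : V} {l : List V} :
    Link G x (y :: l) z ↔ G.Adj x y ∧ Link G y l z := by
  simp [Link]

theorem link_append_cons {x y z : V} {l m : List V} :
    Link G x (l ++ y :: m) z ↔ Link G x l y ∧ Link G y m z := by
  induction l generalizing x with
  | nil => simp [link_cons, link_nil]
  | cons a l ih => simp [link_cons, ih, and_assoc]

theorem link_reverse {x y : V} {l : List V} : Link G x l.reverse y ↔ Link G y l x := by
  induction l generalizing y with
  | nil => simp [link_nil, G.adj_comm]
  | cons a l ih =>
    rw [List.reverse_cons, link_append_cons, ih, link_nil, link_cons, G.adj_comm, and_comm]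

/-- The vertices of the list `l` can be arranged into a closed walk visiting each entry once. -/
def CycOn (G : SimpleGraph V) (l : List V) : Prop :=
  ∃ x m, Link G x m x ∧ (x :: m).Perm l

theorem CycOn.perm {l m : List V} (h : CycOn G l) (hp : l.Perm m) : CycOn G m := by
  obtain ⟨x, k, hk, hp'⟩ := h
  exact ⟨x, k, hk, hp'.trans hp⟩

theorem CycOn.exists_link {l : List V} (h : CycOn G l) {z : V} (hz : z ∈ l) :
    ∃ m, Link G z m z ∧ (z :: m).Perm l := by
  obtain ⟨x, k, hk, hp⟩ := h
  rcases List.mem_cons.1 (hp.mem_iff.2 hz) with rfl | hz'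
  · exact ⟨k, hk, hp⟩
  · obtain ⟨A, B, rfl⟩ := List.append_of_mem hz'
    rw [link_append_cons] at hk
    refine ⟨B ++ x :: A, link_append_cons.2 ⟨hk.2, hk.1⟩, List.Perm.trans ?_ hp⟩
    classical
    rw [List.perm_iff_count]
    intro c
    simp only [List.count_cons, List.count_append]
    ring

/-- Three internally disjoint paths with inner vertices `P`, `Q`, `R` between `x` and `y`, such
that the vertices involved do not lie on a common cycle with no other vertices. -/
structure Theta (G : SimpleGraph V) (x y : V) (P Q R : List V) : Prop where
  nodup : (x :: y :: (P ++ Q ++ R)).Nodup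
  left : Link G x P y
  mid : Link G x Q y
  right : Link G x R y
  not_cyc : ¬ CycOn G (x :: y :: (P ++ Q ++ R))

/-- A theta graph with the fewest vertices and, subject to that, the shortest first path. -/
structure MinTheta (G : SimpleGraph V) (x y : V) (P Q R : List V) : Prop
    extends Theta G x y P Q R where
  min : ∀ x' y' P' Q' R', Theta G x' y' P' Q' R' →
    P.length + Q.length + R.length < P'.length + Q'.length + R'.length ∨
    P.length + Q.length + R.length = P'.length + Q'.length + R'.length ∧ P.length ≤ P'.length

theorem Theta.exists_minTheta {x y : V} {P Q R : List V} (h : Theta G x y P Q R) :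
    ∃ x y P Q R, MinTheta G x y P Q R := by
  classical
  let S : Set (ℕ ×ₗ ℕ) := {n | ∃ x y P Q R, Theta G x y P Q R ∧
    n = toLex (P.length + Q.length + R.length, P.length)}
  have hS : S.Nonempty := ⟨_, x, y, P, Q, R, h, rfl⟩
  obtain ⟨n, ⟨x, y, P, Q, R, hT, rfl⟩, hn⟩ := WellFounded.has_min (wellFounded_lt) S hS
  refine ⟨x, y, P, Q, R, hT, fun x' y' P' Q' R' h' => ?_⟩
  have := hn _ ⟨x', y', P', Q', R', h', rfl⟩
  rw [not_lt, Prod.Lex.toLex_le_toLex] at this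
  exact this

theorem Theta.of_perm {x y x' y' : V} {P Q R P' Q' R' : List V} (h : Theta G x y P Q R)
    (hp : (x' :: y' :: (P' ++ Q' ++ R')).Perm (x :: y :: (P ++ Q ++ R)))
    (h1 : Link G x' P' y') (h2 : Link G x' Q' y') (h3 : Link G x' R' y') :
    Theta G x' y' P' Q' R' :=
  ⟨hp.nodup_iff.2 h.nodup, h1, h2, h3, fun hc => h.not_cyc (hc.perm hp)⟩

theorem MinTheta.of_perm {x y x' y' : V} {P Q R P' Q' R' : List V} (h : MinTheta G x y P Q R)
    (hp : (x' :: y' :: (P' ++ Q' ++ R')).Perm (x :: y :: (P ++ Q ++ R)))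
    (h1 : Link G x' P' y') (h2 : Link G x' Q' y') (h3 : Link G x' R' y')
    (hl : P'.length = P.length) :
    MinTheta G x' y' P' Q' R' := by
  refine ⟨h.toTheta.of_perm hp h1 h2 h3, fun x2 y2 P2 Q2 R2 h' => ?_⟩
  have := h.min _ _ _ _ _ h'
  have hle := hp.length_eq
  simp at hle
  omega

theorem MinTheta.swap {x y : V} {P Q R : List V} (h : MinTheta G x y P Q R) :
    MinTheta G x y P R Q := by
  classical
  refine h.of_perm ?_ h.left h.right h.mid rfl
  rw [List.perm_iff_count]
  intro c
  simp only [List.count_cons, List.count_append]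
  ring

theorem MinTheta.reverse {x y : V} {P Q R : List V} (h : MinTheta G x y P Q R) :
    MinTheta G y x P.reverse Q.reverse R.reverse := by
  classical
  refine h.of_perm ?_ (link_reverse.2 h.left) (link_reverse.2 h.mid) (link_reverse.2 h.right)
    (by simp)
  rw [List.perm_iff_count]
  intro c
  simp only [List.count_cons, List.count_append, List.count_reverse]
  ring

/-- An ear attached to a cycle at two distinct vertices yields a theta graph. -/
theorem CycOn.exists_theta {L P : List V} (hL : CycOn G L) {u w : V} (hu : u ∈ L) (hw : w ∈ L)
    (huw : u ≠ w) (hP : Link G u P w) (hn : (L ++ P).Nodup) (hc : ¬ CycOn G (L ++ P)) :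
    ∃ Q R, Theta G u w P Q R ∧ (u :: w :: (Q ++ R)).Perm L := by
  classical
  obtain ⟨m, hm, hp⟩ := hL.exists_link hu
  obtain ⟨A, B, rfl⟩ := List.append_of_mem
    ((List.mem_cons.1 (hp.mem_iff.2 hw)).resolve_left huw.symm)
  rw [link_append_cons] at hm
  have hp1 : (u :: w :: (A ++ B.reverse)).Perm L := by
    refine List.Perm.trans ?_ hp
    rw [List.perm_iff_count]
    intro c
    simp only [List.count_cons, List.count_append, List.count_reverse]
    ring
  have hp2 : (u :: w :: (P ++ A ++ B.reverse)).Perm (L ++ P) := by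
    rw [List.perm_iff_count] at hp1 ⊢
    intro c
    have := hp1 c
    simp only [List.count_cons, List.count_append, List.count_reverse] at this ⊢
    omega
  exact ⟨A, B.reverse, ⟨hp2.nodup_iff.2 hn, hP, hm.1, link_reverse.2 hm.2,
    fun h => hc (h.perm hp2)⟩, hp1⟩

section MinTheta

variable {x y : V} {P Q R : List V}

theorem Theta.cycOn (h : Theta G x y P Q R) : CycOn G (x :: y :: (Q ++ R)) := by
  classical
  refine ⟨x, Q ++ y :: R.reverse, link_append_cons.2 ⟨h.mid, link_reverse.2 h.right⟩, ?_⟩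
  rw [List.perm_iff_count]
  intro c
  simp only [List.count_cons, List.count_append, List.count_reverse]
  ring

/-- The first path of a minimal theta graph cannot be decomposed into two successive ears. -/
theorem MinTheta.not_two_ears (h : MinTheta G x y P Q R) {P₁ P₂ : List V}
    (hp : (P₁ ++ P₂).Perm P) (h₁ : P₁ ≠ []) (h₂ : P₂ ≠ []) {u w u' w' : V}
    (hu : u ∈ x :: y :: (Q ++ R)) (hw : w ∈ x :: y :: (Q ++ R)) (huw : u ≠ w)
    (hL : Link G u P₁ w)
    (hu' : u' ∈ x :: y :: (Q ++ R) ++ P₁) (hw' : w' ∈ x :: y :: (Q ++ R) ++ P₁) (huw' : u' ≠ w')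
    (hL' : Link G u' P₂ w') : False := by
  classical
  have hall : ((x :: y :: (Q ++ R) ++ P₁) ++ P₂).Perm (x :: y :: (P ++ Q ++ R)) := by
    rw [List.perm_iff_count] at hp ⊢
    intro c
    have := hp c
    simp only [List.count_cons, List.count_append] at this ⊢
    omega
  have hnd := hall.nodup_iff.2 h.nodup
  have hlen := hall.length_eq
  have l₁ := List.length_pos_iff.2 h₁
  have l₂ := List.length_pos_iff.2 h₂
  by_cases hc : CycOn G (x :: y :: (Q ++ R) ++ P₁)
  · obtain ⟨Q', R', hT, hp'⟩ := hc.exists_theta hu' hw' huw' hL' hnd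
      (fun h' => h.not_cyc (h'.perm hall))
    have := h.min _ _ _ _ _ hT
    have := hp'.length_eq
    have := hp.length_eq
    simp at *
    omega
  · obtain ⟨Q', R', hT, hp'⟩ := h.cycOn.exists_theta hu hw huw hL
      (List.Nodup.of_append_left hnd) hc
    have := h.min _ _ _ _ _ hT
    have := hp'.length_eq
    have := hp.length_eq
    simp at *
    omega

end MinTheta

end Bedrossian

namespace Bedrossian

variable {V : Type*} {G : SimpleGraph V} {x y : V} {P Q R : List V}

/-- Among any three neighbours of a vertex, two are adjacent. -/
def ClawFree (G : SimpleGraph V) : Prop :=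
  ∀ ⦃x a b c⦄, G.Adj x a → G.Adj x b → G.Adj x c → a ≠ b → a ≠ c → b ≠ c →
    G.Adj a b ∨ G.Adj a c ∨ G.Adj b c

theorem Theta.not_link (h : Theta G x y P Q R) {m : List V} (hm : Link G x m x)
    (hp : (x :: m).Perm (x :: y :: (P ++ Q ++ R))) : False :=
  h.not_cyc ⟨x, m, hm, hp⟩

theorem Theta.left_ne_nil (h : Theta G x y P Q R) : P ≠ [] := by
  rintro rfl
  have h1 := h.left
  refine h.not_link (m := Q ++ y :: R.reverse)
    (link_append_cons.2 ⟨h.mid, link_reverse.2 h.right⟩) ?_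
  classical
  refine List.perm_iff_count.2 fun c => ?_
  simp only [List.count_cons, List.count_append, List.count_reverse, List.count_nil]
  ring

theorem Theta.mid_ne_nil (h : Theta G x y P Q R) : Q ≠ [] := by
  rintro rfl
  refine h.not_link (m := P ++ y :: R.reverse)
    (link_append_cons.2 ⟨h.left, link_reverse.2 h.right⟩) ?_
  classical
  refine List.perm_iff_count.2 fun c => ?_
  simp only [List.count_cons, List.count_append, List.count_reverse, List.count_nil]
  ring

namespace MinTheta

/-- Apart from the last one, no vertex of the first path has a neighbour on the opposite cycle
other than `x`. -/
theorem not_adj_of_ne_nil_right {A B : List V} {r z : V} (h : MinTheta G x y (A ++ r :: B) Q R)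
    (hB : B ≠ []) (hz : z ∈ y :: (Q ++ R)) : ¬ G.Adj r z := by
  intro hadj
  have hl := link_append_cons.1 h.left
  have hnd := h.nodup
  refine h.not_two_ears (P₁ := A ++ [r]) (P₂ := B) (u := x) (w := z) (u' := r) (w' := y)
    (by simp) (by simp) hB (by simp) (List.mem_cons_of_mem _ hz) ?_
    (link_append_cons.2 ⟨hl.1, link_nil.2 hadj⟩) (by simp) (by simp) ?_ hl.2
  · rintro rfl
    simp at hnd hz
    grind
  · rintro rfl
    simp at hnd

/-- Apart from the first one, no vertex of the first path has a neighbour on the opposite cycle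
other than `y`. -/
theorem not_adj_of_ne_nil_left {A B : List V} {r z : V} (h : MinTheta G x y (A ++ r :: B) Q R)
    (hA : A ≠ []) (hz : z ∈ x :: (Q ++ R)) : ¬ G.Adj r z := by
  have h' := h.reverse
  simp only [List.reverse_append, List.reverse_cons, List.append_assoc, List.singleton_append]
    at h'
  exact h'.not_adj_of_ne_nil_right (by simpa using hA) (by simpa using hz)

/-- The first path is induced. -/
theorem not_adj_of_left {A B C : List V} {r s : V}
    (h : MinTheta G x y (A ++ r :: (B ++ s :: C)) Q R) (hB : B ≠ []) : ¬ G.Adj r s := by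
  intro hadj
  have hl := h.left
  simp only [link_append_cons] at hl
  have hnd := h.nodup
  refine h.not_two_ears (P₁ := A ++ r :: s :: C) (P₂ := B) (u := x) (w := y) (u' := r) (w' := s)
    ?_ (by simp) hB (by simp) (by simp) ?_ ?_ (by simp) (by simp) ?_ hl.2.1
  · classical
    refine List.perm_iff_count.2 fun c => ?_
    simp only [List.count_cons, List.count_append]
    ring
  · rintro rfl
    simp at hnd
  · simp only [link_append_cons, link_cons]
    exact ⟨hl.1, hadj, hl.2.2⟩
  · rintro rfl
    simp [List.nodup_append] at hnd

theorem not_adj_heads {p a : V} (h : MinTheta G x y (p :: P) (a :: Q) R) : ¬ G.Adj p a := by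
  intro hadj
  rcases eq_or_ne P [] with rfl | hP
  · refine h.not_link (m := p :: a :: (Q ++ y :: R.reverse)) ?_ ?_
    · have h1 := link_cons.1 h.left
      have h2 := link_cons.1 h.mid
      exact link_cons.2 ⟨h1.1, link_cons.2 ⟨hadj,
        link_append_cons.2 ⟨h2.2, link_reverse.2 h.right⟩⟩⟩
    · classical
      refine List.perm_iff_count.2 fun c => ?_
      simp only [List.count_cons, List.count_append, List.count_reverse, List.count_nil]
      ring
  · exact h.not_adj_of_ne_nil_right (A := []) hP (z := a) (by simp) hadj

theorem adj_heads (hcf : ClawFree G) {a s : V} (h : MinTheta G x y P (a :: Q) (s :: R)) :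
    G.Adj a s := by
  obtain ⟨p, P, rfl⟩ := List.exists_cons_of_ne_nil h.left_ne_nil
  have h1 := h.not_adj_heads
  have h2 := h.swap.not_adj_heads
  have hnd := h.nodup
  simp at hnd
  have := hcf (link_cons.1 h.left).1 (link_cons.1 h.mid).1 (link_cons.1 h.right).1
    (by grind) (by grind) (by grind)
  tauto

theorem adj_lasts (hcf : ClawFree G) {b t : V} (h : MinTheta G x y P (Q ++ [b]) (R ++ [t])) :
    G.Adj b t := by
  have h' := h.reverse
  simp only [List.reverse_append, List.reverse_cons, List.reverse_nil, List.nil_append,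
    List.singleton_append] at h'
  exact h'.adj_heads hcf

theorem not_adj_head_last {a t : V} (h : MinTheta G x y P (a :: Q) (R ++ [t])) :
    ¬ G.Adj a t := by
  intro hadj
  have h2 := link_cons.1 h.mid
  have h3 := link_append_cons.1 h.right
  refine h.not_link (m := P ++ y :: (Q.reverse ++ a :: t :: R.reverse)) ?_ ?_
  · simp only [link_append_cons, link_reverse, link_cons]
    exact ⟨h.left, h2.2, hadj, h3.1⟩
  · classical
    refine List.perm_iff_count.2 fun c => ?_
    simp only [List.count_cons, List.count_append, List.count_reverse, List.count_nil]
    ring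

theorem not_adj_last (hcf : ClawFree G) {t : V} (h : MinTheta G x y P Q (R ++ [t])) :
    ¬ G.Adj x t := by
  intro hadj
  obtain ⟨p, P, rfl⟩ := List.exists_cons_of_ne_nil h.left_ne_nil
  obtain ⟨a, Q, rfl⟩ := List.exists_cons_of_ne_nil h.mid_ne_nil
  have h1 := h.not_adj_heads
  have h2 := h.not_adj_head_last
  have hnd := h.nodup
  have h3 : ¬ G.Adj p t := by
    rcases eq_or_ne P [] with rfl | hP
    · have h' := h.swap.reverse
      simp only [List.reverse_append, List.reverse_cons, List.reverse_nil, List.nil_append,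
        List.singleton_append] at h'
      exact h'.not_adj_heads
    · exact h.not_adj_of_ne_nil_right (A := []) hP (by simp)
  simp at hnd
  have := hcf (link_cons.1 h.left).1 (link_cons.1 h.mid).1 hadj
    (by grind) (by grind) (by grind)
  tauto

theorem not_adj_head (hcf : ClawFree G) {a : V} (h : MinTheta G x y P (a :: Q) R) :
    ¬ G.Adj y a := by
  have h' := h.reverse.swap
  simp only [List.reverse_cons] at h'
  exact h'.not_adj_last hcf

theorem eq_singleton_of_adj (hcf : ClawFree G) {p : V} (h : MinTheta G x y (p :: P) Q R)
    (hxy : G.Adj x y) : P = [] := by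
  by_contra hP
  obtain ⟨a, Q, rfl⟩ := List.exists_cons_of_ne_nil h.mid_ne_nil
  have h1 := h.not_adj_heads
  have h2 := h.not_adj_head hcf
  have h3 := h.not_adj_of_ne_nil_right (A := []) hP (z := y) (by simp)
  have hnd := h.nodup
  simp at hnd
  have := hcf (link_cons.1 h.left).1 (link_cons.1 h.mid).1 hxy
    (by grind) (by grind) (by grind)
  rw [G.adj_comm a] at this
  tauto

theorem not_adj_second_last (hcf : ClawFree G) {a a' t : V}
    (h : MinTheta G x y P (a :: a' :: Q) (R ++ [t])) : ¬ G.Adj a' t := by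
  intro hadj
  rcases eq_or_ne R [] with rfl | hR
  · exact h.not_adj_last hcf (link_cons.1 h.right).1
  obtain ⟨s, R, rfl⟩ := List.exists_cons_of_ne_nil hR
  have h2 := link_cons.1 (link_cons.1 h.mid).2
  have h3 := h.right
  simp only [List.cons_append, link_append_cons, link_cons] at h3
  refine h.not_link (m := P ++ y :: (Q.reverse ++ a' :: t :: (R.reverse ++ s :: [a]))) ?_ ?_
  · simp only [link_append_cons, link_reverse, link_cons, link_nil]
    exact ⟨h.left, h2.2, hadj, h3.2.1, (h.adj_heads hcf).symm, (link_cons.1 h.mid).1.symm⟩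
  · classical
    refine List.perm_iff_count.2 fun c => ?_
    simp only [List.count_cons, List.count_append, List.count_reverse, List.count_nil]
    ring

theorem exists_mid_eq (hcf : ClawFree G) (h : MinTheta G x y P Q R) :
    ∃ a a' c Q', Q = a :: a' :: c :: Q' := by
  obtain ⟨a, Q, rfl⟩ := List.exists_cons_of_ne_nil h.mid_ne_nil
  rcases Q with _ | ⟨a', _ | ⟨c, Q⟩⟩
  · exact (h.not_adj_head hcf (link_nil.1 (link_cons.1 h.mid).2).symm).elim
  · have hR := h.swap.mid_ne_nil
    rcases List.eq_nil_or_concat R with rfl | ⟨R, t, rfl⟩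
    · exact (hR rfl).elim
    · simp only [List.concat_eq_append] at h
      exact (h.not_adj_second_last hcf (h.adj_lasts (Q := [a]) hcf)).elim
  · exact ⟨_, _, _, _, rfl⟩

theorem not_adj_seconds (hcf : ClawFree G) {a a' t t' : V}
    (h : MinTheta G x y P (a :: a' :: Q) (R ++ [t', t])) : ¬ G.Adj a' t' := by
  intro hadj
  have hQ : Q ≠ [] := by
    obtain ⟨_, _, _, _, h1⟩ := h.exists_mid_eq hcf
    rintro rfl
    simp at h1
  rcases eq_or_ne R [] with rfl | hR
  · obtain ⟨_, _, _, _, h1⟩ := h.swap.exists_mid_eq hcf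
    simp at h1
  obtain ⟨s, R, rfl⟩ := List.exists_cons_of_ne_nil hR
  obtain ⟨Q, b, rfl⟩ := (List.eq_nil_or_concat Q).resolve_left hQ
  simp only [List.concat_eq_append] at h
  have h2 := h.mid
  have h3 := h.right
  simp only [List.cons_append, link_append_cons, link_cons, link_nil] at h2 h3
  have hbt : G.Adj b t := MinTheta.adj_lasts (Q := a :: a' :: Q) (R := s :: R ++ [t']) (y := y)
    (x := x) (P := P) hcf (by simpa using h)
  refine h.not_link (m := P ++ y :: t :: b :: (Q.reverse ++ a' :: t' :: (R.reverse ++ s :: [a])))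
    ?_ ?_
  · simp only [link_append_cons, link_reverse, link_cons, link_nil]
    exact ⟨h.left, h3.2.2.2.symm, hbt.symm, h2.2.2.1, hadj, h3.2.1,
      (h.adj_heads hcf).symm, h2.1.symm⟩
  · classical
    refine List.perm_iff_count.2 fun c => ?_
    simp only [List.count_cons, List.count_append, List.count_reverse, List.count_nil]
    ring

end MinTheta

end Bedrossian

namespace Bedrossian

variable {V : Type*} {G : SimpleGraph V} {x y p : V} {P Q R : List V}

namespace MinTheta

/-- A path through vertices of the opposite cycle, closed up at `x`, can be reinserted into any
cycle avoiding it. -/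
theorem not_cycOn_of_link (hcf : ClawFree G) (h : MinTheta G x y (p :: P) Q R)
    (hp : ∀ z ∈ Q ++ R, ¬ G.Adj p z) {L M : List V} {m c : V} (hM : Link G x (M ++ [m]) x)
    (hsub : ∀ z ∈ M ++ [m], z ∈ Q ++ R)
    (hperm : (L ++ (M ++ [m])).Perm (x :: y :: ((p :: P) ++ Q ++ R)))
    (hcL : c ∈ L) (hc : c ∈ Q ++ R) : ¬ CycOn G L := by
  classical
  intro hL
  have hnd := h.nodup
  have hnd' := hperm.nodup_iff.2 hnd
  have hmem : ∀ z ∈ L, z = x ∨ z = y ∨ z = p ∨ z ∈ P ∨ z ∈ Q ++ R := by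
    intro z hz
    have := hperm.mem_iff.1 (List.mem_append_left _ hz)
    simp only [List.mem_cons, List.mem_append] at this ⊢
    tauto
  have hxL : x ∈ L := by
    have := (hperm.mem_iff (a := x)).2 (by simp)
    refine (List.mem_append.1 this).resolve_right fun h' => ?_
    have := hsub _ h'
    simp at hnd this
    grind
  have key : ∀ g k, Link G x (g :: k) x → (x :: g :: k).Perm L → g ∉ Q ++ R := by
    intro g k hk hkL hg
    have hM' := link_append_cons.1 hM
    have hgL : g ∈ L := hkL.mem_iff.1 (by simp)
    have hpx := (link_cons.1 h.left).1
    have hpn : p ∉ Q ++ R := by simp at hnd ⊢; grind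
    have hm : m ∈ Q ++ R := hsub _ (by simp)
    have hmg : m ≠ g := by
      rintro rfl
      simp [List.nodup_append] at hnd'
      grind
    have := hcf hpx (link_nil.1 hM'.2).symm (link_cons.1 hk).1
      (by rintro rfl; exact hpn hm) (by rintro rfl; exact hpn hg) hmg
    have hmg : G.Adj m g := by
      have h1 := hp _ hm
      have h2 := hp _ hg
      tauto
    refine h.not_link (m := M ++ m :: g :: k)
      (link_append_cons.2 ⟨hM'.1, link_cons.2 ⟨hmg, (link_cons.1 hk).2⟩⟩) ?_
    refine List.Perm.trans ?_ hperm
    rw [List.perm_iff_count] at hkL ⊢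
    intro c
    have := hkL c
    simp only [List.count_cons, List.count_append, List.count_nil] at this ⊢
    omega
  obtain ⟨k, hk, hkL⟩ := hL.exists_link hxL
  have hxc : x ≠ c := by
    rintro rfl
    simp at hnd hc
    grind
  have hck : c ∈ k := by
    have := hkL.mem_iff.2 hcL
    grind
  have hgp : ∀ g k, Link G x (g :: k) x → (x :: g :: k).Perm L → g = p ∨ g = y := by
    intro g k hk hkL
    have hgx : g ≠ x := by
      rintro rfl
      exact (link_cons.1 hk).1.ne rfl
    have hgL : g ∈ L := hkL.mem_iff.1 (by simp)
    rcases hmem g hgL with h1 | h1 | h1 | h1 | h1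
    · exact (hgx h1).elim
    · exact .inr h1
    · exact .inl h1
    · obtain ⟨A, B, rfl⟩ := List.append_of_mem h1
      exact (h.not_adj_of_ne_nil_left (A := p :: A) (by simp) (z := x) (by simp)
        (link_cons.1 hk).1.symm).elim
    · exact (key g k hk hkL h1).elim
  have hfin : ∀ k l, Link G x (p :: (k ++ [l])) x → (x :: p :: (k ++ [l])).Perm L →
      l = y → c ∈ p :: (k ++ [l]) → False := by
    rintro k l hk hkL rfl hck
    have hxl : G.Adj x l := by
      have := link_append_cons (l := p :: k) (m := []) |>.1 hk
      exact (link_nil.1 this.2).symm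
    obtain rfl := h.eq_singleton_of_adj hcf hxl
    have hLn : (x :: p :: (k ++ [l])).Nodup := hkL.nodup_iff.2 (List.Nodup.of_append_left hnd')
    rcases k with _ | ⟨d, k⟩
    · simp at hnd hck hc
      grind
    · have hd := hmem d (hkL.mem_iff.1 (by simp))
      have hpd := (link_cons.1 (link_cons.1 hk).2).1
      have := hp d
      simp at hLn hd this
      grind
  rcases k with _ | ⟨g, k⟩
  · simp at hck
  rcases List.eq_nil_or_concat k with rfl | ⟨k, l, rfl⟩
  · simp only [List.mem_singleton] at hck
    subst hck
    exact key _ _ hk hkL hc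
  simp only [List.concat_eq_append] at hk hkL hck
  have hk' : Link G x (l :: (k.reverse ++ [g])) x := by
    have := link_reverse.2 hk
    simpa using this
  have hkL' : (x :: l :: (k.reverse ++ [g])).Perm L := by
    refine List.Perm.trans ?_ hkL
    refine List.perm_iff_count.2 fun c => ?_
    simp only [List.count_cons, List.count_append, List.count_reverse, List.count_nil]
    ring
  have hLn : (x :: g :: (k ++ [l])).Nodup := hkL.nodup_iff.2 (List.Nodup.of_append_left hnd')
  have hgl : g ≠ l := by
    rintro rfl
    simp at hLn
  rcases hgp _ _ hk hkL with rfl | h1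
  · exact hfin _ _ hk hkL ((hgp _ _ hk' hkL').resolve_left hgl.symm) hck
  · have h2 : l = p := (hgp _ _ hk' hkL').resolve_right fun h2 => hgl (h1.trans h2.symm)
    subst h2
    exact hfin _ _ hk' hkL' h1 (by simp at hck ⊢; tauto)

/-- There is no smaller theta graph spanning the complement of a path closed up at `x`. -/
theorem not_theta_of_link (hcf : ClawFree G) (h : MinTheta G x y (p :: P) Q R)
    (hp : ∀ z ∈ Q ++ R, ¬ G.Adj p z) {M : List V} {m c x' y' : V} {P' Q' R' : List V}
    (hM : Link G x (M ++ [m]) x) (hsub : ∀ z ∈ M ++ [m], z ∈ Q ++ R)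
    (hperm : (x' :: y' :: (P' ++ Q' ++ R') ++ (M ++ [m])).Perm (x :: y :: ((p :: P) ++ Q ++ R)))
    (hcL : c ∈ x' :: y' :: (P' ++ Q' ++ R')) (hc : c ∈ Q ++ R)
    (h1 : Link G x' P' y') (h2 : Link G x' Q' y') (h3 : Link G x' R' y') : False := by
  have hT : Theta G x' y' P' Q' R' :=
    ⟨List.Nodup.of_append_left (hperm.nodup_iff.2 h.nodup), h1, h2, h3,
      h.not_cycOn_of_link hcf hp hM hsub hperm hcL hc⟩
  have := h.min _ _ _ _ _ hT
  have hle := hperm.length_eq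
  simp at this hle
  omega

theorem not_adj_mid (hcf : ClawFree G) {a d : V} (h : MinTheta G x y (p :: P) (a :: Q) R)
    (hp : ∀ z ∈ a :: Q ++ R, ¬ G.Adj p z) (hd : d ∈ Q) : ¬ G.Adj x d := by
  classical
  intro hxd
  obtain ⟨A, B, rfl⟩ := List.append_of_mem hd
  rcases B with _ | ⟨e, B⟩
  · exact h.swap.not_adj_last (R := a :: A) hcf hxd
  have hs : ∃ s R', R = s :: R' := List.exists_cons_of_ne_nil h.swap.mid_ne_nil
  obtain ⟨s, R, rfl⟩ := hs
  have hmid : Link G x (a :: A) d ∧ G.Adj d e ∧ Link G e B y := by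
    have := link_append_cons (l := a :: A).1 h.mid
    exact ⟨this.1, link_cons.1 this.2⟩
  by_cases hxe : G.Adj x e
  · refine h.not_theta_of_link hcf hp (M := a :: A) (m := d) (c := s)
      (link_append_cons.2 ⟨hmid.1, link_nil.2 hxd.symm⟩) ?_ ?_ (by simp) (by simp) h.left
      (link_cons.2 ⟨hxe, hmid.2.2⟩) h.right
    · intro z hz
      simp at hz ⊢
      tauto
    · refine List.perm_iff_count.2 fun c => ?_
      simp only [List.count_cons, List.count_append, List.count_nil]
      ring
  obtain ⟨C, q, hC⟩ := (List.eq_nil_or_concat (a :: A)).resolve_left (by simp)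
  rw [List.concat_eq_append] at hC
  rw [hC, link_append_cons, link_nil] at hmid
  by_cases hxq : G.Adj x q
  · refine h.not_theta_of_link hcf hp (M := C) (m := q) (c := s)
      (link_append_cons.2 ⟨hmid.1.1, link_nil.2 hxq.symm⟩) ?_ ?_ (by simp) (by simp) h.left
      (link_cons.2 ⟨hxd, link_cons.2 hmid.2⟩) h.right
    · intro z hz
      rw [← hC] at hz
      simp at hz ⊢
      tauto
    · rw [← hC]
      refine List.perm_iff_count.2 fun c => ?_
      simp only [List.count_cons, List.count_append]
      ring
  have hqA : q ∈ a :: A := by simp [hC]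
  have hnd := h.nodup
  have hqe : G.Adj q e := by
    have := hcf hxd.symm hmid.1.2.symm hmid.2.1 (by simp at hnd hqA; grind)
      (by simp at hnd hqA; grind) (by simp [List.nodup_append] at hnd hqA; grind)
    tauto
  refine h.not_theta_of_link hcf hp (M := []) (m := d) (c := s) (P' := p :: P)
    (Q' := C ++ q :: e :: B)
    (R' := s :: R)
      (link_append_cons.2 ⟨link_nil.2 hxd, link_nil.2 hxd.symm⟩) ?_ ?_ (by simp) (by simp) h.left
      (link_append_cons.2 ⟨hmid.1.1, link_cons.2 ⟨hqe, hmid.2.2⟩⟩) h.right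
  · intro z hz
    simp at hz ⊢
    tauto
  · have : C ++ q :: e :: B = (a :: A) ++ e :: B := by simp [hC]
    rw [this]
    refine List.perm_iff_count.2 fun c => ?_
    simp only [List.count_cons, List.count_append, List.count_nil]
    ring

theorem not_adj_second_head (hcf : ClawFree G) {a a' s : V}
    (h : MinTheta G x y (p :: P) (a :: a' :: Q) (s :: R))
    (hp : ∀ z ∈ a :: a' :: Q ++ s :: R, ¬ G.Adj p z) : ¬ G.Adj a' s := by
  classical
  intro hadj
  have h2 := link_cons.1 h.mid
  have h3 := link_cons.1 h.right
  refine h.not_theta_of_link hcf hp (M := []) (m := a) (c := s) (x' := s) (y' := y)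
    (P' := x :: p :: P) (Q' := a' :: Q) (R' := R)
      (link_append_cons.2 ⟨link_nil.2 h2.1, link_nil.2 h2.1.symm⟩) ?_ ?_ (by simp) (by simp)
      (link_cons.2 ⟨h3.1.symm, h.left⟩) (link_cons.2 ⟨hadj.symm, (link_cons.1 h2.2).2⟩) h3.2
  · intro z hz
    simp at hz ⊢
    tauto
  · refine List.perm_iff_count.2 fun c => ?_
    simp only [List.count_cons, List.count_append, List.count_nil]
    ring

theorem not_adj_second_second (hcf : ClawFree G) {a a' s s' : V}
    (h : MinTheta G x y (p :: P) (a :: a' :: Q) (s :: s' :: R))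
    (hp : ∀ z ∈ a :: a' :: Q ++ s :: s' :: R, ¬ G.Adj p z) : ¬ G.Adj a' s' := by
  classical
  intro hadj
  have h2 := link_cons.1 h.mid
  have h3 := link_cons.1 h.right
  refine h.not_theta_of_link hcf hp (M := []) (m := s) (c := a) (x' := a') (y' := y)
    (P' := a :: x :: p :: P) (Q' := Q) (R' := s' :: R)
      (link_append_cons.2 ⟨link_nil.2 h3.1, link_nil.2 h3.1.symm⟩) ?_ ?_ (by simp) (by simp)
      (link_cons.2 ⟨(link_cons.1 h2.2).1.symm, link_cons.2 ⟨h2.1.symm, h.left⟩⟩)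
      (link_cons.1 h2.2).2 (link_cons.2 ⟨hadj, (link_cons.1 h3.2).2⟩)
  · intro z hz
    simp at hz ⊢
    tauto
  · refine List.perm_iff_count.2 fun c => ?_
    simp only [List.count_cons, List.count_append, List.count_nil]
    ring

end MinTheta

end Bedrossian

namespace Bedrossian

theorem nonempty_embedding_of_adj_iff {V W : Type*} {G : SimpleGraph V} {H : SimpleGraph W}
    (f : W → V) (hf : ∀ i j, G.Adj (f i) (f j) ↔ H.Adj i j)
    (hH : ∀ i j, (∀ k, H.Adj i k ↔ H.Adj j k) → i = j) : Nonempty (H ↪g G) :=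
  ⟨⟨⟨f, fun i j hij => hH i j fun k => by rw [← hf, ← hf, hij]⟩, hf _ _⟩⟩

theorem nonempty_embedding_of_lt {V W : Type*} [LinearOrder W] {G : SimpleGraph V}
    {H : SimpleGraph W}
    (f : W → V) (hf : ∀ i j, i < j → (G.Adj (f i) (f j) ↔ H.Adj i j))
    (hH : ∀ i j, (∀ k, H.Adj i k ↔ H.Adj j k) → i = j) : Nonempty (H ↪g G) := by
  refine nonempty_embedding_of_adj_iff f (fun i j => ?_) hH
  rcases lt_trichotomy i j with h | rfl | h
  · exact hf i j h
  · simp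
  · rw [G.adj_comm, H.adj_comm, hf j i h]

instance : DecidableRel netGraph.Adj := fun i j =>
  decidable_of_iff ((s(i, j) = s(0,1) ∨ s(i, j) = s(0,2) ∨ s(i, j) = s(1,2) ∨ s(i, j) = s(0,3) ∨
    s(i, j) = s(1,4) ∨ s(i, j) = s(2,5)) ∧ i ≠ j) (by simp [netGraph])

instance : DecidableRel woundedGraph.Adj := fun i j =>
  decidable_of_iff ((s(i, j) = s(0,1) ∨ s(i, j) = s(0,2) ∨ s(i, j) = s(1,2) ∨ s(i, j) = s(0,3) ∨
    s(i, j) = s(1,4) ∨ s(i, j) = s(4,5)) ∧ i ≠ j) (by simp [woundedGraph])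

variable {V : Type*} {G : SimpleGraph V} {a b c d e f : V}

theorem netGraph_embedding (hab : G.Adj a b) (hac : G.Adj a c) (hbc : G.Adj b c)
    (had : G.Adj a d) (hbe : G.Adj b e) (hcf : G.Adj c f)
    (hae : ¬ G.Adj a e) (haf : ¬ G.Adj a f) (hbd : ¬ G.Adj b d) (hbf : ¬ G.Adj b f)
    (hcd : ¬ G.Adj c d) (hce : ¬ G.Adj c e) (hde : ¬ G.Adj d e) (hdf : ¬ G.Adj d f)
    (hef : ¬ G.Adj e f) : Nonempty (netGraph ↪g G) := by
  refine nonempty_embedding_of_lt ![a, b, c, d, e, f] (fun i j hij => ?_) (by decide)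
  fin_cases i <;> fin_cases j <;> simp [netGraph] at hij ⊢ <;> assumption

theorem woundedGraph_embedding (hab : G.Adj a b) (hac : G.Adj a c) (hbc : G.Adj b c)
    (had : G.Adj a d) (hbe : G.Adj b e) (hef : G.Adj e f)
    (hae : ¬ G.Adj a e) (haf : ¬ G.Adj a f) (hbd : ¬ G.Adj b d) (hbf : ¬ G.Adj b f)
    (hcd : ¬ G.Adj c d) (hce : ¬ G.Adj c e) (hcf : ¬ G.Adj c f) (hde : ¬ G.Adj d e)
    (hdf : ¬ G.Adj d f) : Nonempty (woundedGraph ↪g G) := by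
  refine nonempty_embedding_of_lt ![a, b, c, d, e, f] (fun i j hij => ?_) (by decide)
  fin_cases i <;> fin_cases j <;> simp [woundedGraph] at hij ⊢ <;> assumption

theorem pathGraph_six_embedding (hab : G.Adj a b) (hbc : G.Adj b c) (hcd : G.Adj c d)
    (hde : G.Adj d e) (hef : G.Adj e f)
    (hac : ¬ G.Adj a c) (had : ¬ G.Adj a d) (hae : ¬ G.Adj a e) (haf : ¬ G.Adj a f)
    (hbd : ¬ G.Adj b d) (hbe : ¬ G.Adj b e) (hbf : ¬ G.Adj b f) (hce : ¬ G.Adj c e)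
    (hcf : ¬ G.Adj c f) (hdf : ¬ G.Adj d f) :
    Nonempty (SimpleGraph.pathGraph 6 ↪g G) := by
  refine nonempty_embedding_of_lt ![a, b, c, d, e, f] (fun i j hij => ?_)
    (by simp only [SimpleGraph.pathGraph_adj]; decide)
  fin_cases i <;> fin_cases j <;> simp [SimpleGraph.pathGraph_adj] at hij ⊢ <;> assumption

end Bedrossian

namespace Bedrossian

variable {V : Type*} {G : SimpleGraph V} {x y p v : V} {P Q R : List V}

namespace MinTheta

theorem exists_not_adj_second (hcf : ClawFree G) (h : MinTheta G x y P Q R) :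
    ∃ a a' Q' U, MinTheta G x y P (a :: a' :: Q') (U ++ R) ∧ ¬ G.Adj x a' := by
  induction Q generalizing R with
  | nil => exact (h.mid_ne_nil rfl).elim
  | cons a Q ih =>
    obtain ⟨_, a', c, Q', h1⟩ := h.exists_mid_eq hcf
    obtain ⟨rfl, rfl⟩ := List.cons_eq_cons.1 h1
    by_cases hx : G.Adj x a'
    · obtain ⟨s, R, rfl⟩ := List.exists_cons_of_ne_nil h.swap.mid_ne_nil
      have h2 := link_cons.1 h.mid
      have h' : MinTheta G x y P (a' :: c :: Q') (a :: s :: R) := by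
        classical
        refine h.of_perm ?_ h.left (link_cons.2 ⟨hx, (link_cons.1 h2.2).2⟩)
          (link_cons.2 ⟨h2.1, link_cons.2 ⟨h.adj_heads hcf, (link_cons.1 h.right).2⟩⟩) rfl
        refine List.perm_iff_count.2 fun c => ?_
        simp only [List.count_cons, List.count_append]
        ring
      obtain ⟨b, b', Q'', U, h3, h4⟩ := ih h'
      exact ⟨b, b', Q'', U ++ [a], by simpa using h3, h4⟩
    · exact ⟨a, a', c :: Q', [], h, hx⟩

theorem exists_not_adj_seconds (hcf : ClawFree G) (h : MinTheta G x y P Q R) :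
    ∃ a a' Q' R' t' t, MinTheta G x y P (a :: a' :: Q') (R' ++ [t', t]) ∧ ¬ G.Adj x a' ∧
      ¬ G.Adj y t' := by
  obtain ⟨a, a', Q', U, h1, hx⟩ := h.exists_not_adj_second hcf
  obtain ⟨t, t', R', W, h2, hy⟩ := h1.reverse.swap.exists_not_adj_second hcf
  refine ⟨a, a', Q' ++ W.reverse, R'.reverse, t', t, ?_, hx, hy⟩
  simpa using h2.reverse.swap

theorem not_adj_second_of_singleton (hcf : ClawFree G) {a a' : V}
    (h : MinTheta G x y [v] (a :: a' :: Q) R) : ¬ G.Adj v a' := by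
  intro hadj
  have h1 := link_cons.1 h.left
  have h2 := link_cons.1 h.mid
  have h3 := link_cons.1 h2.2
  have h' : MinTheta G x a' [v] [a] (R ++ y :: Q.reverse) := by
    classical
    refine h.of_perm ?_ (link_cons.2 ⟨h1.1, link_nil.2 hadj⟩)
      (link_cons.2 ⟨h2.1, link_nil.2 h3.1⟩)
      (link_append_cons.2 ⟨h.right, link_reverse.2 h3.2⟩) rfl
    refine List.perm_iff_count.2 fun c => ?_
    simp only [List.count_cons, List.count_append, List.count_reverse, List.count_nil]
    ring
  obtain ⟨_, _, _, _, h4⟩ := h'.exists_mid_eq hcf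
  simp at h4

/-- The case of adjacent branch vertices. -/
theorem embedding_of_adj (hcf : ClawFree G) (h : MinTheta G x y P Q R) (hxy : G.Adj x y) :
    Nonempty (woundedGraph ↪g G) ∧ Nonempty (SimpleGraph.pathGraph 6 ↪g G) := by
  obtain ⟨a, a', Q, R, t', t, h, hxa', hyt'⟩ := h.exists_not_adj_seconds hcf
  obtain ⟨v, P, rfl⟩ := List.exists_cons_of_ne_nil h.left_ne_nil
  obtain rfl := h.eq_singleton_of_adj hcf hxy
  have hr : MinTheta G y x [v] (t :: t' :: R.reverse) (Q.reverse ++ [a', a]) := by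
    simpa using h.reverse.swap
  have hs : MinTheta G x y [v] (a :: a' :: Q) (R ++ [t'] ++ [t]) := by simpa using h
  have hrs : MinTheta G y x [v] (t :: t' :: R.reverse) (Q.reverse ++ [a'] ++ [a]) := by
    simpa using hr
  have hxv : G.Adj x v := (link_cons.1 h.left).1
  have hvy : G.Adj v y := link_nil.1 (link_cons.1 h.left).2
  have hxa : G.Adj x a := (link_cons.1 h.mid).1
  have haa' : G.Adj a a' := (link_cons.1 (link_cons.1 h.mid).2).1
  have hyt : G.Adj y t := (link_cons.1 hr.mid).1
  have htt' : G.Adj t t' := (link_cons.1 (link_cons.1 hr.mid).2).1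
  have hva : ¬ G.Adj v a := h.not_adj_heads
  have hvt : ¬ G.Adj v t := hr.not_adj_heads
  have hva' : ¬ G.Adj v a' := h.not_adj_second_of_singleton hcf
  have hvt' : ¬ G.Adj v t' := hr.not_adj_second_of_singleton hcf
  have hat : ¬ G.Adj a t := hs.not_adj_head_last
  have ha't : ¬ G.Adj a' t := hs.not_adj_second_last hcf
  have hat' : ¬ G.Adj a t' := fun h' => hrs.not_adj_second_last hcf h'.symm
  have ha't' : ¬ G.Adj a' t' := h.not_adj_seconds hcf
  have hxt : ¬ G.Adj x t := hs.not_adj_last hcf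
  have hya : ¬ G.Adj y a := h.not_adj_head hcf
  have hnd := h.nodup
  simp at hnd
  have hxt' : ¬ G.Adj x t' := fun h' => by
    have := hcf hxv hxa h' (by grind) (by grind) (by grind)
    tauto
  have hya' : ¬ G.Adj y a' := fun h' => by
    have := hcf hvy.symm hyt h' (by grind) (by grind) (by grind)
    rw [G.adj_comm t] at this
    tauto
  constructor
  · apply woundedGraph_embedding (a := y) (b := x) (c := v) (d := t) (e := a) (f := a') <;>
      first | assumption | (rw [G.adj_comm]; assumption)
  · apply pathGraph_six_embedding (a := a') (b := a) (c := x) (d := y) (e := t) (f := t') <;>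
      first | assumption | (rw [G.adj_comm]; assumption)

/-- The case of a vertex with three neighbours on the opposite cycle. -/
theorem embedding_of_adj_mid {z : V} (hcf : ClawFree G) (h : MinTheta G x y [v] Q R)
    (hvz : G.Adj v z) (hz : z ∈ Q) :
    Nonempty (netGraph ↪g G) ∧ Nonempty (woundedGraph ↪g G) ∧
      Nonempty (SimpleGraph.pathGraph 6 ↪g G) := by
  classical
  obtain ⟨A, C, rfl⟩ := List.append_of_mem hz
  rcases A with _ | ⟨a, A⟩
  · exact (h.not_adj_heads hvz).elim
  rcases C with _ | ⟨c, C⟩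
  · have h' := h.reverse
    simp only [List.reverse_append, List.reverse_cons, List.reverse_nil, List.nil_append,
      List.singleton_append] at h'
    exact (h'.not_adj_heads hvz).elim
  rcases List.eq_nil_or_concat R with rfl | ⟨R, t, rfl⟩
  · exact (h.swap.mid_ne_nil rfl).elim
  rw [List.concat_eq_append] at h
  have hxv : G.Adj x v := (link_cons.1 h.left).1
  have hvy : G.Adj v y := link_nil.1 (link_cons.1 h.left).2
  have hm := link_append_cons.1 h.mid
  have hxa := link_cons.1 hm.1
  have hzc := link_cons.1 hm.2
  have hrt := link_append_cons.1 h.right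
  have h2 : MinTheta G x z [v] (a :: A) (R ++ t :: y :: C.reverse ++ [c]) := by
    refine h.of_perm ?_ (link_cons.2 ⟨hxv, link_nil.2 hvz⟩) hm.1 ?_ rfl
    · refine List.perm_iff_count.2 fun c => ?_
      simp only [List.count_cons, List.count_append, List.count_reverse, List.count_nil]
      ring
    · simp only [List.append_assoc, List.cons_append, link_append_cons, link_cons, link_reverse,
        link_nil]
      exact ⟨hrt.1, link_nil.1 hrt.2, hzc.2, hzc.1.symm⟩
  have h3 : MinTheta G z y [v] (c :: C) (A.reverse ++ a :: x :: R ++ [t]) := by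
    refine h.of_perm ?_ (link_cons.2 ⟨hvz.symm, link_nil.2 hvy⟩) hm.2 ?_ rfl
    · refine List.perm_iff_count.2 fun c => ?_
      simp only [List.count_cons, List.count_append, List.count_reverse, List.count_nil]
      ring
    · simp only [List.append_assoc, List.cons_append, link_append_cons, link_cons, link_reverse,
        link_nil]
      exact ⟨hxa.2, hxa.1.symm, hrt.1, link_nil.1 hrt.2⟩
  have hr : MinTheta G y x [v] (t :: R.reverse) (C.reverse ++ c :: z :: A.reverse ++ [a]) := by
    simpa using h.reverse.swap
  replace hxa := hxa.1
  replace hzc := hzc.1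
  have hyt := (link_cons.1 hr.mid).1
  have hat : ¬ G.Adj a t := h.not_adj_head_last
  have hac : ¬ G.Adj a c := h2.not_adj_head_last
  have hct : ¬ G.Adj c t := h3.not_adj_head_last
  have hxt : ¬ G.Adj x t := h.not_adj_last hcf
  have hya : ¬ G.Adj y a := h.not_adj_head hcf
  have hza : ¬ G.Adj z a := h2.not_adj_head hcf
  have hxc : ¬ G.Adj x c := h2.not_adj_last hcf
  have hyc : ¬ G.Adj y c := h3.not_adj_head hcf
  have hzt : ¬ G.Adj z t := h3.not_adj_last hcf
  have hva : ¬ G.Adj v a := h.not_adj_heads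
  have hvc : ¬ G.Adj v c := h3.not_adj_heads
  have hvt : ¬ G.Adj v t := hr.not_adj_heads
  have hnd := h.nodup
  have hxy : x ≠ y := by
    rintro rfl
    simp at hnd
  have hxz : x ≠ z := by
    rintro rfl
    simp at hnd
  have hyz : y ≠ z := by
    rintro rfl
    simp at hnd
  have hne : ∀ {u w}, G.Adj v u → ¬ G.Adj v w → u ≠ w := by
    rintro u _ h1 h2 rfl
    exact h2 h1
  have hc1 := hcf hxv.symm hvy hvz hxy hxz hyz
  have hc2 : G.Adj x y → G.Adj x z → G.Adj y z := fun h1 h2 => by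
    have := hcf h1 h2 hxa hyz (hne hvy hva) (hne hvz hva)
    exact this.resolve_right (not_or_intro hya hza)
  have hc3 : G.Adj x y → G.Adj y z → G.Adj x z := fun h1 h2 => by
    have := hcf h1.symm h2 hyt hxz (hne hxv.symm hvt) (hne hvz hvt)
    exact this.resolve_right (not_or_intro hxt hzt)
  have hc4 : G.Adj x z → G.Adj y z → G.Adj x y := fun h1 h2 => by
    have := hcf h1.symm h2.symm hzc hxy (hne hxv.symm hvc) (hne hvy hvc)
    exact this.resolve_right (not_or_intro hxc hyc)
  constructor
  · by_cases hxy : G.Adj x y <;> by_cases hxz : G.Adj x z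
    · have := hc2 hxy hxz
      apply netGraph_embedding (a := x) (b := y) (c := z) (d := a) (e := t) (f := c) <;>
        first | assumption | (rw [G.adj_comm]; assumption)
    · have : ¬ G.Adj y z := fun h' => hxz (hc3 hxy h')
      apply netGraph_embedding (a := x) (b := y) (c := v) (d := a) (e := t) (f := z) <;>
        first | assumption | (rw [G.adj_comm]; assumption)
    · have : ¬ G.Adj y z := fun h' => hxy (hc4 hxz h')
      apply netGraph_embedding (a := x) (b := z) (c := v) (d := a) (e := c) (f := y) <;>
        first | assumption | (rw [G.adj_comm]; assumption)
    · have : G.Adj y z := (hc1.resolve_left hxy).resolve_left hxz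
      apply netGraph_embedding (a := y) (b := z) (c := v) (d := t) (e := c) (f := x) <;>
        first | assumption | (rw [G.adj_comm]; assumption)
  · rcases hc1 with hc | hc | hc
    · exact h.embedding_of_adj hcf hc
    · exact h2.embedding_of_adj hcf hc
    · exact h3.embedding_of_adj hcf hc.symm

theorem netGraph_embedding_of_not_adj (hcf : ClawFree G) (h : MinTheta G x y (p :: P) Q R)
    (hp : ∀ z ∈ Q ++ R, ¬ G.Adj p z) : Nonempty (netGraph ↪g G) := by
  obtain ⟨a, a', c, Q, rfl⟩ := h.exists_mid_eq hcf
  obtain ⟨s, s', d, R, rfl⟩ := h.swap.exists_mid_eq hcf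
  have hp' : ∀ z ∈ s :: s' :: d :: R ++ a :: a' :: c :: Q, ¬ G.Adj p z :=
    fun z hz => hp z (List.mem_append.2 (List.mem_append.1 hz).symm)
  have h1 := link_cons.1 h.mid
  have h2 := link_cons.1 h.right
  have h3 := h.swap.not_adj_second_head hcf hp'
  have h4 := h.not_adj_second_head hcf hp
  exact netGraph_embedding h1.1 h2.1 (h.adj_heads hcf) (link_cons.1 h.left).1
    (link_cons.1 h1.2).1 (link_cons.1 h2.2).1 (h.not_adj_mid hcf hp (by simp))
    (h.swap.not_adj_mid hcf hp' (by simp)) (fun h' => hp a (by simp) h'.symm)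
    (fun h' => h3 h'.symm)
    (fun h' => hp s (by simp) h'.symm) (fun h' => h4 h'.symm) (hp a' (by simp)) (hp s' (by simp))
    (h.not_adj_second_second hcf hp)

theorem embedding_of_not_adj (hcf : ClawFree G) (h : MinTheta G x y (p :: P) Q R)
    (hp : ∀ z ∈ Q ++ R, ¬ G.Adj p z) (hxy : ¬ G.Adj x y) :
    Nonempty (woundedGraph ↪g G) ∧ Nonempty (SimpleGraph.pathGraph 6 ↪g G) := by
  obtain ⟨a, a', c, Q, rfl⟩ := h.exists_mid_eq hcf
  rcases List.eq_nil_or_concat R with rfl | ⟨R, t, rfl⟩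
  · exact (h.swap.mid_ne_nil rfl).elim
  obtain ⟨s, R', hR⟩ := List.exists_cons_of_ne_nil h.swap.mid_ne_nil
  have hs := h
  have hps := hp
  rw [List.concat_eq_append] at h hp
  rw [hR] at hs hps
  have hya' : ¬ G.Adj y a' := by
    obtain ⟨Q', b, hQ⟩ := (List.eq_nil_or_concat (c :: Q)).resolve_left (by simp)
    rw [List.concat_eq_append] at hQ
    obtain ⟨P', q, hP⟩ := (List.eq_nil_or_concat (p :: P)).resolve_left (by simp)
    rw [List.concat_eq_append] at hP
    have h' := h
    rw [hQ, hP] at h'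
    have hr : MinTheta G y x (q :: P'.reverse) (b :: (Q'.reverse ++ [a', a]))
        (t :: R.reverse) := by simpa using h'.reverse
    refine hr.not_adj_mid hcf ?_ (by simp)
    rw [hQ] at hp
    rcases eq_or_ne P' [] with rfl | hP'
    · obtain ⟨rfl, -⟩ : p = q ∧ P = [] := by simpa using hP
      intro z hz
      refine hp z ?_
      simp at hz ⊢
      tauto
    · intro z hz
      refine h'.not_adj_of_ne_nil_left (A := P') (B := []) hP' ?_
      simp at hz ⊢
      tauto
  have hxp : G.Adj x p := (link_cons.1 h.left).1
  have hxa : G.Adj x a := (link_cons.1 h.mid).1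
  have hxs : G.Adj x s := (link_cons.1 hs.right).1
  have haa' : G.Adj a a' := (link_cons.1 (link_cons.1 h.mid).2).1
  have has : G.Adj a s := hs.adj_heads hcf
  have ha's : ¬ G.Adj a' s := hs.not_adj_second_head hcf hps
  have hxa' : ¬ G.Adj x a' := h.not_adj_mid hcf hp (by simp)
  have hpa : ¬ G.Adj p a := hp a (by simp)
  have hpa' : ¬ G.Adj p a' := hp a' (by simp)
  have hps' : ¬ G.Adj p s := hps s (by simp)
  have hya : ¬ G.Adj y a := h.not_adj_head hcf
  have hys : ¬ G.Adj y s := hs.swap.not_adj_head hcf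
  rcases P with _ | ⟨p₂, P⟩
  · have hpy : G.Adj p y := link_nil.1 (link_cons.1 h.left).2
    have hpt : ¬ G.Adj p t := hp t (by simp)
    have ha't : ¬ G.Adj a' t := h.not_adj_second_last hcf
    have hat : ¬ G.Adj a t := h.not_adj_head_last
    have hxt : ¬ G.Adj x t := h.not_adj_last hcf
    have hty : G.Adj t y := link_nil.1 (link_append_cons.1 h.right).2
    constructor
    · apply woundedGraph_embedding (a := a) (b := x) (c := s) (d := a') (e := p) (f := y) <;>
        first | assumption | (rw [G.adj_comm]; assumption)
    · apply pathGraph_six_embedding (a := a') (b := a) (c := x) (d := p) (e := y) (f := t) <;>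
        first | assumption | (rw [G.adj_comm]; assumption)
  have hpp := link_cons.1 (link_cons.1 h.left).2
  have h₂ : ∀ z ∈ x :: (a :: a' :: c :: Q ++ s :: R'), ¬ G.Adj p₂ z := fun z =>
    hs.not_adj_of_ne_nil_left (A := [p]) (by simp)
  have hxp₂ : ¬ G.Adj p₂ x := h₂ x (by simp)
  have hap₂ : ¬ G.Adj p₂ a := h₂ a (by simp)
  have ha'p₂ : ¬ G.Adj p₂ a' := h₂ a' (by simp)
  have hsp₂ : ¬ G.Adj p₂ s := h₂ s (by simp)
  have hpp₂ := hpp.1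
  constructor
  · apply woundedGraph_embedding (a := a) (b := x) (c := s) (d := a') (e := p) (f := p₂) <;>
      first | assumption | (rw [G.adj_comm]; assumption)
  rcases P with _ | ⟨p₃, P⟩
  · have hpy : ¬ G.Adj p y := h.not_adj_of_ne_nil_right (A := []) (by simp) (by simp)
    have hp₂y : G.Adj p₂ y := link_nil.1 hpp.2
    apply pathGraph_six_embedding (a := a') (b := a) (c := x) (d := p) (e := p₂) (f := y) <;>
      first | assumption | (rw [G.adj_comm]; assumption)
  · have hp₃ := (link_cons.1 hpp.2).1
    have h₃ : ∀ z ∈ x :: (a :: a' :: c :: Q ++ s :: R'), ¬ G.Adj p₃ z := fun z =>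
      hs.not_adj_of_ne_nil_left (A := [p, p₂]) (by simp)
    have hxp₃ : ¬ G.Adj p₃ x := h₃ x (by simp)
    have hap₃ : ¬ G.Adj p₃ a := h₃ a (by simp)
    have ha'p₃ : ¬ G.Adj p₃ a' := h₃ a' (by simp)
    have hpp₃ : ¬ G.Adj p p₃ := h.not_adj_of_left (A := []) (B := [p₂]) (by simp)
    apply pathGraph_six_embedding (a := a') (b := a) (c := x) (d := p) (e := p₂) (f := p₃) <;>
      first | assumption | (rw [G.adj_comm]; assumption)

theorem embedding (hcf : ClawFree G) (h : MinTheta G x y P Q R) :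
    Nonempty (netGraph ↪g G) ∧ Nonempty (woundedGraph ↪g G) ∧
      Nonempty (SimpleGraph.pathGraph 6 ↪g G) := by
  obtain ⟨p, P, rfl⟩ := List.exists_cons_of_ne_nil h.left_ne_nil
  by_cases hp : ∀ z ∈ Q ++ R, ¬ G.Adj p z
  · refine ⟨h.netGraph_embedding_of_not_adj hcf hp, ?_⟩
    by_cases hxy : G.Adj x y
    · exact h.embedding_of_adj hcf hxy
    · exact h.embedding_of_not_adj hcf hp hxy
  · push Not at hp
    obtain ⟨z, hz, hpz⟩ := hp
    rcases eq_or_ne P [] with rfl | hP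
    · rcases List.mem_append.1 hz with hz | hz
      · exact h.embedding_of_adj_mid hcf hpz hz
      · exact h.swap.embedding_of_adj_mid hcf hpz hz
    · exact (h.not_adj_of_ne_nil_right (A := []) hP (List.mem_cons_of_mem _ hz) hpz).elim

end MinTheta

end Bedrossian

namespace Bedrossian

variable {V : Type*} {G : SimpleGraph V}

theorem Link.exists_walk {x y : V} {l : List V} (h : Link G x l y) :
    ∃ p : G.Walk x y, p.support = x :: (l ++ [y]) := by
  induction l generalizing x with
  | nil => exact ⟨.cons (link_nil.1 h) .nil, by simp⟩
  | cons a l ih =>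
    obtain ⟨p, hp⟩ := ih (link_cons.1 h).2
    exact ⟨.cons (link_cons.1 h).1 p, by simp [hp]⟩

/-- A spanning closed walk through each of at least three vertices once is a Hamilton cycle. -/
theorem CycOn.isHamiltonian [Fintype V] [DecidableEq V] {l : List V} (h : CycOn G l)
    (hl : l.Nodup) (hV : ∀ v, v ∈ l) (hc : 3 ≤ Fintype.card V) : G.IsHamiltonian := by
  obtain ⟨x, m, hm, hp⟩ := h
  have hnd := hp.nodup_iff.2 hl
  have hlen : (x :: m).length = Fintype.card V := by
    rw [← List.toFinset_card_of_nodup hnd, ← Finset.card_univ]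
    congr 1
    ext v
    simpa using hp.mem_iff.2 (hV v)
  rcases m with _ | ⟨a, _ | ⟨b, m⟩⟩
  · simp at hlen
    omega
  · simp at hlen
    omega
  obtain ⟨q, hq⟩ := (link_cons.1 (link_cons.1 hm).2).2.exists_walk
  have hxa := (link_cons.1 hm).1
  have hab := (link_cons.1 (link_cons.1 hm).2).1
  intro _
  have hperm : (a :: b :: (m ++ [x])).Perm (x :: a :: b :: m) := by
    refine List.perm_iff_count.2 fun c => ?_
    simp only [List.count_cons, List.count_append, List.count_nil]
    ring
  have hnd' := hperm.nodup_iff.2 hnd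
  have hpath : (SimpleGraph.Walk.cons hab q).IsPath := by
    rw [SimpleGraph.Walk.isPath_def]
    simpa [hq] using hnd'
  have hcyc : (SimpleGraph.Walk.cons hxa (.cons hab q)).IsCycle := by
    rw [SimpleGraph.Walk.cons_isCycle_iff]
    refine ⟨hpath, ?_⟩
    simp only [SimpleGraph.Walk.edges_cons, List.mem_cons, not_or]
    constructor
    · intro h'
      simp only [Sym2.eq_iff] at h'
      simp at hnd
      grind
    · intro h'
      have := q.snd_mem_support_of_mem_edges h'
      rw [hq] at this
      simp at hnd' this
      grind
  refine ⟨x, _, ⟨hcyc, ?_⟩⟩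
  intro v
  have hv : v ∈ a :: b :: (m ++ [x]) := (hperm.trans hp).mem_iff.2 (hV v)
  rw [SimpleGraph.Walk.support_tail_of_not_nil _ (by simp)]
  simp only [SimpleGraph.Walk.support_cons, List.tail_cons, hq]
  exact List.count_eq_one_of_mem hnd' hv

/-- A path that ends in `S` contains an initial segment meeting `S` in its last vertex only. -/
theorem exists_link_first {u : V} (S : Set V) {w z : ({u}ᶜ : Set V)}
    (p : (G.induce ({u}ᶜ : Set V)).Walk w z) (hp : p.IsPath) (hz : (z : V) ∈ S)
    (hw : (w : V) ∉ S) :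
    ∃ l f, Link G w l f ∧ f ∈ S ∧ f ≠ u ∧ ((w : V) :: l).Nodup ∧ (∀ v ∈ l, v ∉ S) ∧
      ∀ v ∈ (w : V) :: l, v ∈ p.support.map Subtype.val := by
  induction p with
  | nil => exact (hw hz).elim
  | @cons w b z hwb q ih =>
    rw [SimpleGraph.Walk.cons_isPath_iff] at hp
    by_cases hb : (b : V) ∈ S
    · exact ⟨[], b, link_nil.2 hwb, hb, b.2, by simp, by simp, by simp⟩
    · obtain ⟨l, f, h1, h2, h3, h4, h5, h6⟩ := ih hp.1 hz hb
      refine ⟨b :: l, f, link_cons.2 ⟨hwb, h1⟩, h2, h3, List.nodup_cons.2 ⟨fun h => ?_, h4⟩, ?_, ?_⟩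
      · obtain ⟨w', hw', h7⟩ := List.mem_map.1 (h6 _ h)
        exact hp.2 (Subtype.ext h7 ▸ hw')
      · intro v hv
        rcases List.mem_cons.1 hv with rfl | hv
        · exact hb
        · exact h5 v hv
      · intro v hv
        rw [SimpleGraph.Walk.support_cons, List.map_cons]
        rcases List.mem_cons.1 hv with rfl | hv
        · exact List.mem_cons_self
        · exact List.mem_cons_of_mem _ (h6 v hv)

theorem _root_.TwoConnected.exists_adj_of_mem [Fintype V] (hG : TwoConnected G) {S : Set V}
    {u v z : V} (hu : u ∈ S) (hv : v ∉ S) (huz : u ≠ z) (hvz : v ≠ z) :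
    ∃ a b, a ∈ S ∧ b ∉ S ∧ G.Adj a b := by
  obtain ⟨p⟩ := (hG.2 z).preconnected ⟨u, huz⟩ ⟨v, hvz⟩
  obtain ⟨d, -, h1, h2⟩ := p.exists_boundary_dart (Subtype.val ⁻¹' S) hu hv
  exact ⟨_, _, h1, h2, d.adj⟩

theorem _root_.TwoConnected.exists_theta [Fintype V] [DecidableEq V] (hG : TwoConnected G)
    (hham : ¬ G.IsHamiltonian) : ∃ x y P Q R, Theta G x y P Q R := by
  obtain ⟨u, v, z, huv, huz, hvz⟩ := Fintype.two_lt_card_iff.1 hG.1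
  obtain ⟨a, b, ha, hb, hab⟩ := hG.exists_adj_of_mem (S := {u}) rfl huv.symm huz hvz
  let N : Set ℕ := {n | ∃ l : List V, l.Nodup ∧ CycOn G l ∧ l.length = n}
  have hN : N.Nonempty := ⟨2, [a, b], by simp [hab.ne], ⟨a, [b], link_cons.2
    ⟨hab, link_nil.2 hab.symm⟩, List.Perm.refl _⟩, rfl⟩
  have hbdd : BddAbove N := ⟨Fintype.card V, by
    rintro _ ⟨l, hl, -, rfl⟩
    exact hl.length_le_card⟩
  obtain ⟨L, hL, hc, hlen⟩ := Nat.sSup_mem hN hbdd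
  have hmax : ∀ l : List V, l.Nodup → CycOn G l → l.length ≤ L.length := fun l h1 h2 =>
    hlen ▸ le_csSup hbdd ⟨l, h1, h2, rfl⟩
  by_cases hall : ∀ v, v ∈ L
  · exact (hham (hc.isHamiltonian hL hall hG.1)).elim
  push Not at hall
  obtain ⟨v, hv⟩ := hall
  obtain ⟨x, m, hm, hp⟩ := id hc
  obtain ⟨y, m, rfl⟩ : ∃ y m', m = y :: m' := by
    refine List.exists_cons_of_ne_nil ?_
    rintro rfl
    exact (link_nil.1 hm).ne rfl
  have hxL : x ∈ L := hp.mem_iff.1 (by simp)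
  have hyL : y ∈ L := hp.mem_iff.1 (by simp)
  have hxy : x ≠ y := (link_cons.1 hm).1.ne
  obtain ⟨u, w, hu, hw, huw⟩ := hG.exists_adj_of_mem (S := {v | v ∈ L}) (z := y) hxL hv hxy
    (by rintro rfl; exact hv hyL)
  obtain ⟨t, htL, htu⟩ : ∃ t ∈ L, t ≠ u := by
    by_cases h : x = u
    · exact ⟨y, hyL, h ▸ hxy.symm⟩
    · exact ⟨x, hxL, h⟩
  obtain ⟨p⟩ := (hG.2 u).preconnected ⟨w, huw.ne'⟩ ⟨t, htu⟩
  obtain ⟨l, f, h1, h2, h3, h4, h5, -⟩ :=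
    exists_link_first {v | v ∈ L} p.bypass p.bypass_isPath htL hw
  have hnd : (L ++ w :: l).Nodup := by
    refine List.nodup_append.2 ⟨hL, h4, ?_⟩
    rintro c hc _ hd rfl
    rcases List.mem_cons.1 hd with rfl | hd
    · exact hw hc
    · exact h5 c hd hc
  obtain ⟨Q, R, hT, -⟩ := hc.exists_theta hu h2 h3.symm (link_cons.2 ⟨huw, h1⟩) hnd fun h => by
    have := hmax _ hnd h
    simp at this
  exact ⟨_, _, _, _, _, hT⟩

theorem _root_.TwoConnected.embedding [Fintype V] [DecidableEq V] (hG : TwoConnected G)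
    (hham : ¬ G.IsHamiltonian) (hcf : ClawFree G) :
    Nonempty (netGraph ↪g G) ∧ Nonempty (woundedGraph ↪g G) ∧
      Nonempty (SimpleGraph.pathGraph 6 ↪g G) := by
  obtain ⟨_, _, _, _, _, h⟩ := hG.exists_theta hham
  obtain ⟨_, _, _, _, _, h⟩ := h.exists_minTheta
  exact h.embedding hcf

end Bedrossian

namespace Bedrossian

theorem indFree_iff {V W : Type*} {G : SimpleGraph V} {H : SimpleGraph W} :
    IndFree G H ↔ ¬ Nonempty (H ↪g G) := by
  refine not_congr ⟨?_, ?_⟩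
  · rintro ⟨s, ⟨f⟩⟩
    exact ⟨(SimpleGraph.Embedding.induce s).comp f.toEmbedding⟩
  · rintro ⟨f⟩
    refine ⟨Set.range f, ⟨⟨Equiv.ofInjective f f.injective, ?_⟩⟩⟩
    intro a b
    simp

theorem clawFree_of_not_embedding {V : Type*} {G : SimpleGraph V}
    (h : ¬ Nonempty (clawGraph ↪g G)) : ClawFree G := by
  intro x a b c hxa hxb hxc hab hac hbc
  by_contra hcon
  push Not at hcon
  obtain ⟨h1, h2, h3⟩ := hcon
  refine h ⟨⟨⟨![x, a, b, c], ?_⟩, ?_⟩⟩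
  · intro i j
    have := hxa.ne
    have := hxb.ne
    have := hxc.ne
    fin_cases i <;> fin_cases j <;> simp <;> grind
  · intro i j
    have h4 : ¬ G.Adj b a := fun h => h1 h.symm
    have h5 : ¬ G.Adj c a := fun h => h2 h.symm
    have h6 : ¬ G.Adj c b := fun h => h3 h.symm
    have h7 := hxa.symm
    have h8 := hxb.symm
    have h9 := hxc.symm
    fin_cases i <;> fin_cases j <;> simp [clawGraph] <;> assumption

theorem pathGraph_embedding {m n : ℕ} (h : m ≤ n) :
    Nonempty (SimpleGraph.pathGraph m ↪g SimpleGraph.pathGraph n) :=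
  ⟨⟨Fin.castLEEmb h, by simp [SimpleGraph.pathGraph_adj]⟩⟩

theorem not_isOneOfBedrossian {V W : Type*} {G : SimpleGraph V} {S : SimpleGraph W}
    (hN : Nonempty (netGraph ↪g G)) (hW : Nonempty (woundedGraph ↪g G))
    (hP : Nonempty (SimpleGraph.pathGraph 6 ↪g G)) (hS : ¬ Nonempty (S ↪g G)) :
    ¬ IsOneOfBedrossian S := by
  obtain ⟨fN⟩ := hN
  obtain ⟨fW⟩ := hW
  obtain ⟨fP⟩ := hP
  rintro (⟨⟨f⟩⟩ | ⟨⟨f⟩⟩ | ⟨⟨f⟩⟩ | ⟨⟨f⟩⟩ | ⟨⟨f⟩⟩ | ⟨⟨f⟩⟩ | ⟨⟨f⟩⟩ | ⟨⟨f⟩⟩ | ⟨⟨f⟩⟩) <;> apply hS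
  · obtain ⟨g⟩ := pathGraph_embedding (m := 4) (n := 6) (by norm_num)
    exact ⟨fP.comp (g.comp f.toEmbedding)⟩
  · obtain ⟨g⟩ := pathGraph_embedding (m := 5) (n := 6) (by norm_num)
    exact ⟨fP.comp (g.comp f.toEmbedding)⟩
  · exact ⟨fP.comp f.toEmbedding⟩
  · refine ⟨fN.comp (SimpleGraph.Embedding.comp ⟨⟨![0, 1, 2], by decide⟩, ?_⟩ f.toEmbedding)⟩
    intro i j
    fin_cases i <;> fin_cases j <;> simp [triangleGraph, netGraph]
  · refine ⟨fN.comp (SimpleGraph.Embedding.comp ⟨⟨![0, 1, 2, 5], by decide⟩, ?_⟩ f.toEmbedding)⟩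
    intro i j
    fin_cases i <;> fin_cases j <;> simp [Z1, netGraph]
  · refine ⟨fW.comp (SimpleGraph.Embedding.comp ⟨⟨![0, 2, 1, 4, 5], by decide⟩, ?_⟩
      f.toEmbedding)⟩
    intro i j
    fin_cases i <;> fin_cases j <;> simp [Z2, woundedGraph]
  · refine ⟨fN.comp (SimpleGraph.Embedding.comp ⟨⟨![0, 1, 2, 3, 4], by decide⟩, ?_⟩
      f.toEmbedding)⟩
    intro i j
    fin_cases i <;> fin_cases j <;> simp [bullGraph, netGraph]
  · exact ⟨fN.comp f.toEmbedding⟩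
  · exact ⟨fW.comp f.toEmbedding⟩

theorem _root_.TwoConnected.isHamiltonian {V α β : Type*} [Fintype V] [DecidableEq V]
    {G : SimpleGraph V} {R : SimpleGraph α} {S : SimpleGraph β} (hG : TwoConnected G)
    (hR : IndFree G R) (hS : IndFree G S) (hRc : Nonempty (R ≃g clawGraph))
    (hSb : IsOneOfBedrossian S) : G.IsHamiltonian := by
  by_contra hham
  rw [indFree_iff] at hR hS
  obtain ⟨f⟩ := hRc
  have hcf := clawFree_of_not_embedding fun ⟨g⟩ => hR ⟨g.comp f.toEmbedding⟩
  obtain ⟨hN, hW, hP⟩ := hG.embedding hham hcf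
  exact not_isOneOfBedrossian hN hW hP hS hSb

end Bedrossian

namespace Bedrossian

section Search

/-- `ok c j v l` says that the value `v` at position `j` is compatible, in the sense of `c`, with
the list `l` of values at the previous positions (the latest one first). -/
def ok (c : ℕ → ℕ → ℕ → ℕ → Bool) (j v : ℕ) : List ℕ → Bool
  | [] => true
  | w :: l => c j l.length v w && ok c j v l

/-- Backtracking search for `k` further values from `vs`, extending the values in `l`, such that
all pairs of values are compatible in the sense of `c`. -/
def search (c : ℕ → ℕ → ℕ → ℕ → Bool) (vs : List ℕ) : ℕ → List ℕ → Bool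
  | 0, _ => true
  | k + 1, l => vs.any fun v => ok c l.length v l && search c vs k (v :: l)

variable {c : ℕ → ℕ → ℕ → ℕ → Bool} {vs : List ℕ}

theorem ok_map_range {j v n : ℕ} {f : ℕ → ℕ} :
    ok c j v ((List.range n).reverse.map f) = true ↔ ∀ i < n, c j i v (f i) = true := by
  induction n with
  | zero => simp [ok]
  | succ n ih =>
    simp only [List.range_succ, List.reverse_append, List.reverse_cons, List.reverse_nil,
      List.nil_append, List.singleton_append, List.map_cons, ok, Bool.and_eq_true, ih,
      List.length_map, List.length_reverse, List.length_range, Nat.lt_succ_iff_lt_or_eq]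
    grind

theorem search_eq_true_iff {k n : ℕ} {g : ℕ → ℕ} :
    search c vs k ((List.range n).reverse.map g) = true ↔
      ∃ f : ℕ → ℕ, (∀ i < n, f i = g i) ∧ (∀ i, n ≤ i → i < n + k → f i ∈ vs) ∧
        ∀ j, n ≤ j → j < n + k → ∀ i < j, c j i (f j) (f i) = true := by
  induction k generalizing n g with
  | zero =>
    simp only [search, true_iff]
    exact ⟨g, by simp, by intros; omega, by intros; omega⟩
  | succ k ih =>
    have hcons : ∀ v, v :: (List.range n).reverse.map g =
        (List.range (n + 1)).reverse.map (Function.update g n v) := by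
      intro v
      simp only [List.range_succ, List.reverse_append, List.reverse_cons, List.reverse_nil,
        List.nil_append, List.singleton_append, List.map_cons, Function.update_self,
        List.cons.injEq, true_and]
      refine List.map_congr_left fun i hi => ?_
      rw [Function.update_of_ne]
      simp at hi
      omega
    simp only [search, List.any_eq_true, Bool.and_eq_true, List.length_map, List.length_reverse,
      List.length_range, ok_map_range, hcons, ih]
    constructor
    · rintro ⟨v, hv, h1, f, h2, h3, h4⟩
      have hfn : f n = v := by simpa using h2 n (by omega)
      have hf : ∀ i < n, f i = g i := fun i hi => by
        rw [h2 i (by omega), Function.update_of_ne (by omega)]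
      refine ⟨f, hf, fun i hi hi' => ?_, fun j hj hj' i hi => ?_⟩
      · rcases eq_or_lt_of_le hi with rfl | hi
        · rwa [hfn]
        · exact h3 i hi (by omega)
      · rcases eq_or_lt_of_le hj with rfl | hj
        · rw [hfn, hf i hi]
          exact h1 i hi
        · exact h4 j hj (by omega) i hi
    · rintro ⟨f, h2, h3, h4⟩
      refine ⟨f n, h3 n le_rfl (by omega), fun i hi => ?_, f, fun i hi => ?_,
        fun i hi hi' => h3 i (by omega) (by omega), fun j hj hj' => h4 j (by omega) (by omega)⟩
      · rw [← h2 i hi]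
        exact h4 n le_rfl (by omega) i hi
      · rcases Nat.lt_succ_iff_lt_or_eq.1 hi with hi | rfl
        · rw [Function.update_of_ne (by omega), h2 i hi]
        · simp

theorem search_nil_eq_true_iff {k : ℕ} :
    search c vs k [] = true ↔ ∃ f : ℕ → ℕ, (∀ i < k, f i ∈ vs) ∧
      ∀ j < k, ∀ i < j, c j i (f j) (f i) = true := by
  simpa using search_eq_true_iff (c := c) (vs := vs) (k := k) (n := 0) (g := id)

end Search

/-- Adjacency according to the adjacency lists `r`; each edge needs to be listed only once. -/
def adjB (r : List (List ℕ)) (i j : ℕ) : Bool :=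
  i != j && ((r.getD i []).elem j || (r.getD j []).elem i)

/-- The graph with adjacency lists `r`. -/
def listGraph (r : List (List ℕ)) : SimpleGraph (Fin r.length) where
  Adj i j := adjB r i j = true
  symm := ⟨fun i j h => by
    simp only [adjB, Bool.and_eq_true, bne_iff_ne, Bool.or_eq_true] at h ⊢
    exact ⟨h.1.symm, h.2.symm⟩⟩
  loopless := ⟨fun i h => by simp [adjB] at h⟩

theorem listGraph_adj {r : List (List ℕ)} {i j : Fin r.length} :
    (listGraph r).Adj i j ↔ adjB r i j = true := Iff.rfl

theorem adjB_comm (r : List (List ℕ)) (i j : ℕ) : adjB r i j = adjB r j i := by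
  simp only [adjB]
  rw [Bool.or_comm, bne_comm]

theorem adjB_self (r : List (List ℕ)) (i : ℕ) : adjB r i i = false := by
  simp [adjB]

/-- Search for an induced copy of the graph `s` in the graph `r` with vertices in `vs`. -/
def embB (s r : List (List ℕ)) (vs : List ℕ) : Bool :=
  search (fun j i v w => v != w && adjB r v w == adjB s j i) vs s.length []

theorem exists_embedding_of_embB {s r : List (List ℕ)} {vs : List ℕ} (h : embB s r vs = true)
    (hvs : ∀ v ∈ vs, v < r.length) :
    ∃ f : listGraph s ↪g listGraph r, ∀ i, (f i : ℕ) ∈ vs := by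
  obtain ⟨f, h1, h2⟩ := search_nil_eq_true_iff.1 h
  simp only [Bool.and_eq_true, bne_iff_ne, beq_iff_eq] at h2
  refine ⟨⟨⟨fun i => ⟨f i, hvs _ (h1 i i.2)⟩, fun i j hij => ?_⟩, fun {i j} => ?_⟩,
    fun i => h1 i i.2⟩
  · simp only [Fin.mk.injEq] at hij
    rcases lt_trichotomy i j with hlt | rfl | hlt
    · exact ((h2 j j.2 i hlt).1 hij.symm).elim
    · rfl
    · exact ((h2 i i.2 j hlt).1 hij).elim
  · change adjB r (f i) (f j) = true ↔ adjB s i j = true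
    rcases lt_trichotomy i j with hlt | rfl | hlt
    · rw [adjB_comm r, adjB_comm s, (h2 j j.2 i hlt).2]
    · simp [adjB_self]
    · rw [(h2 i i.2 j hlt).2]

theorem embB_of_embedding {s r : List (List ℕ)} (f : listGraph s ↪g listGraph r) :
    embB s r (List.range r.length) = true := by
  refine search_nil_eq_true_iff.2
    ⟨fun i => if h : i < s.length then f ⟨i, h⟩ else 0, fun i hi => by simp [hi], ?_⟩
  intro j hj i hi
  have hi' : i < s.length := by omega
  simp only [hj, hi', dif_pos, Bool.and_eq_true, bne_iff_ne, beq_iff_eq]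
  refine ⟨fun h => ?_, ?_⟩
  · have := f.injective (Fin.ext h)
    simp only [Fin.mk.injEq] at this
    omega
  · have := f.map_rel_iff (a := ⟨j, hj⟩) (b := ⟨i, hi'⟩)
    rw [listGraph_adj, listGraph_adj] at this
    rwa [Bool.eq_iff_iff]

/-- Search for a Hamilton cycle. -/
def hamB (r : List (List ℕ)) : Bool :=
  search (fun j i v w => v != w && (j != i + 1 || adjB r v w) &&
    (i != 0 || j + 1 != r.length || adjB r v w)) (List.range r.length) r.length []

theorem not_isHamiltonian_of_hamB {r : List (List ℕ)} (h : hamB r = false)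
    (hr : r.length ≠ 1) : ¬ (listGraph r).IsHamiltonian := by
  intro hham
  obtain ⟨a, p, hp⟩ := hham (by simpa using hr)
  have hlen : p.length = r.length := by simpa using hp.length_eq
  rw [← Bool.not_eq_true] at h
  refine h (search_nil_eq_true_iff.2 ⟨fun i => p.getVert i, fun i hi => by simp, ?_⟩)
  intro j hj i hi
  simp only [Bool.and_eq_true, bne_iff_ne, Bool.or_eq_true, ← listGraph_adj]
  refine ⟨⟨fun h' => ?_, ?_⟩, ?_⟩
  · have := hp.isCycle.getVert_injOn' (by simp; omega) (by simp; omega) (Fin.ext h')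
    omega
  · by_cases hij : j = i + 1
    · subst hij
      exact .inr (p.adj_getVert_succ (by omega)).symm
    · exact .inl hij
  · by_cases hi0 : i = 0
    · by_cases hj1 : j + 1 = r.length
      · have := p.adj_getVert_succ (i := j) (by omega)
        rw [show j + 1 = p.length by omega, p.getVert_length] at this
        subst hi0
        rw [p.getVert_zero]
        exact .inr this
      · exact .inl (.inr hj1)
    · exact .inl (.inl hi0)

/-- The vertices of `vs` reached by `n` steps of breadth-first search starting from `A`. -/
def reach (r : List (List ℕ)) (vs : List ℕ) : ℕ → List ℕ → List ℕ
  | 0, A => A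
  | n + 1, A => reach r vs n (vs.filter fun v => A.elem v || A.any (adjB r v))

/-- A test for the graph `r` being 2-connected. -/
def twoConnB (r : List (List ℕ)) : Bool :=
  (List.range r.length).all fun v =>
    let vs := (List.range r.length).filter (· != v)
    vs.all (reach r vs r.length (vs.take 1)).elem

theorem reachable_of_mem_reach {r : List (List ℕ)} {vs : List ℕ} {S : Set (Fin r.length)}
    (hvs : ∀ v ∈ vs, ∃ h : v < r.length, ⟨v, h⟩ ∈ S) {a : S} {n : ℕ} {A : List ℕ}
    (hA : ∀ v ∈ A, ∃ b : S, (b : ℕ) = v ∧ ((listGraph r).induce S).Reachable a b) :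
    ∀ v ∈ reach r vs n A, ∃ b : S, (b : ℕ) = v ∧ ((listGraph r).induce S).Reachable a b := by
  induction n generalizing A with
  | zero => exact hA
  | succ n ih =>
    refine ih fun v hv => ?_
    simp only [List.mem_filter, Bool.or_eq_true, List.elem_eq_mem, decide_eq_true_eq,
      List.any_eq_true] at hv
    obtain ⟨hv, hv' | ⟨w, hw, hvw⟩⟩ := hv
    · exact hA v hv'
    · obtain ⟨b, rfl, hb⟩ := hA w hw
      obtain ⟨h, hS⟩ := hvs v hv
      refine ⟨⟨_, hS⟩, rfl, hb.trans (SimpleGraph.Adj.reachable ?_)⟩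
      rw [SimpleGraph.comap_adj, listGraph_adj, adjB_comm]
      exact hvw

theorem twoConnected_of_twoConnB {r : List (List ℕ)} (h : twoConnB r = true)
    (hr : 3 ≤ r.length) : TwoConnected (listGraph r) := by
  refine ⟨by simpa using hr, fun v => ?_⟩
  have h1 := List.all_eq_true.1 h v (by simp)
  dsimp only at h1
  set vs := (List.range r.length).filter (· != (v : ℕ)) with hvs
  have hmem : ∀ w, w ∈ vs ↔ w < r.length ∧ w ≠ v := by simp [hvs]
  have hvs' : ∀ w ∈ vs, ∃ h : w < r.length, (⟨w, h⟩ : Fin r.length) ∈ ({v}ᶜ : Set _) := by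
    intro w hw
    rw [hmem] at hw
    exact ⟨hw.1, fun h' => hw.2 (congrArg Fin.val h')⟩
  obtain ⟨a, ha⟩ : ∃ a, a ∈ vs := by
    by_cases hv : (v : ℕ) = 0
    · exact ⟨1, (hmem 1).2 ⟨by omega, by omega⟩⟩
    · exact ⟨0, (hmem 0).2 ⟨by omega, by omega⟩⟩
  obtain ⟨a, l, hal⟩ := List.exists_cons_of_ne_nil (List.ne_nil_of_mem ha)
  obtain ⟨ha1, ha2⟩ := hvs' a (by simp [hal])
  rw [SimpleGraph.connected_iff_exists_forall_reachable]
  refine ⟨⟨_, ha2⟩, fun ⟨w, hw⟩ => ?_⟩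
  have hwvs : (w : ℕ) ∈ vs := (hmem w).2 ⟨w.2, fun h' => hw (Fin.ext h')⟩
  have h2 := List.all_eq_true.1 h1 w hwvs
  simp only [List.elem_eq_mem, decide_eq_true_eq] at h2
  have h3 : ∀ u ∈ vs.take 1, ∃ b : ({v}ᶜ : Set (Fin r.length)), (b : ℕ) = u ∧
      ((listGraph r).induce {v}ᶜ).Reachable ⟨_, ha2⟩ b := by
    intro u hu
    simp only [hal, List.take_succ_cons, List.take_zero, List.mem_singleton] at hu
    exact ⟨⟨_, ha2⟩, hu.symm, .refl _⟩
  obtain ⟨b, hb, hab⟩ := reachable_of_mem_reach hvs' h3 _ h2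
  have : b = ⟨w, hw⟩ := Subtype.ext (Fin.ext hb)
  exact this ▸ hab

/-- A test that detects disconnected induced subgraphs. -/
def disconnB (r : List (List ℕ)) (vs : List ℕ) : Bool :=
  let A := reach r vs r.length (vs.take 1)
  vs.any A.elem && !vs.all A.elem &&
    vs.all fun u => vs.all fun v => !A.elem u || !adjB r u v || A.elem v

theorem disconnB_eq_false {V : Type*} {X : SimpleGraph V} {r : List (List ℕ)} {vs : List ℕ}
    (hX : X.Connected) (f : X ↪g listGraph r) (hvs : ∀ v, v ∈ vs ↔ ∃ x, (f x : ℕ) = v) :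
    disconnB r vs = false := by
  rw [← Bool.not_eq_true]
  intro h
  unfold disconnB at h
  dsimp only at h
  generalize reach r vs r.length (vs.take 1) = A at h
  simp only [Bool.and_eq_true, List.any_eq_true, List.elem_eq_mem, decide_eq_true_eq,
    List.all_eq_true, Bool.or_eq_true, Bool.not_eq_true', ← Bool.not_eq_true, not_forall] at h
  obtain ⟨⟨⟨u, hu, huA⟩, v, hv, hvA⟩, h⟩ := h
  obtain ⟨x, rfl⟩ := (hvs u).1 hu
  obtain ⟨y, rfl⟩ := (hvs v).1 hv
  obtain ⟨p⟩ := hX.preconnected x y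
  obtain ⟨d, -, h1, h2⟩ := p.exists_boundary_dart {z | (f z : ℕ) ∈ A} huA hvA
  have h3 := h _ ((hvs _).2 ⟨d.fst, rfl⟩) _ ((hvs _).2 ⟨d.snd, rfl⟩)
  have h4 := f.map_rel_iff.2 d.adj
  rw [listGraph_adj] at h4
  have h1 : (f d.fst : ℕ) ∈ A := h1
  have h2 : (f d.snd : ℕ) ∉ A := h2
  tauto

/-- A test for every connected induced subgraph of the graph `r` on at least three vertices to
contain one of the graphs in `bad` or be isomorphic to one of the graphs in `good`. -/
def classifyB (r : List (List ℕ)) (bad good : List (List (List ℕ))) : Bool :=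
  (List.range r.length).sublists'.all fun vs =>
    decide (vs.length < 3) || disconnB r vs || bad.any (fun s => embB s r vs) ||
      good.any fun s => s.length == vs.length && embB s r vs

theorem exists_embedding_or_iso {V : Type*} [Fintype V] {X : SimpleGraph V}
    {r : List (List ℕ)} {bad good : List (List (List ℕ))} (h : classifyB r bad good = true)
    (hX : X.Connected) (hc : 3 ≤ Fintype.card V) (hf : Nonempty (X ↪g listGraph r)) :
    (∃ s ∈ bad, Nonempty (listGraph s ↪g X)) ∨ ∃ s ∈ good, Nonempty (X ≃g listGraph s) := by
  classical
  obtain ⟨f⟩ := hf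
  set vs := (List.range r.length).filter fun v => decide (∃ x, (f x : ℕ) = v) with hvs
  have hmem : ∀ v, v ∈ vs ↔ ∃ x, (f x : ℕ) = v := by
    intro v
    simp only [hvs, List.mem_filter, List.mem_range, decide_eq_true_eq, and_iff_right_iff_imp]
    rintro ⟨x, rfl⟩
    exact (f x).2
  have hlt : ∀ v ∈ vs, v < r.length := fun v hv => by
    obtain ⟨x, rfl⟩ := (hmem v).1 hv
    exact (f x).2
  have hlen : vs.length = Fintype.card V := by
    have hnd : vs.Nodup := List.nodup_range.filter _
    have hinj : Function.Injective fun x => (f x : ℕ) := Fin.val_injective.comp f.injective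
    rw [← List.toFinset_card_of_nodup hnd, ← Finset.card_univ,
      ← Finset.card_image_of_injective _ hinj]
    congr 1
    ext v
    simp [hmem]
  have hemb : ∀ s, embB s r vs = true → Nonempty (listGraph s ↪g X) := by
    intro s hs
    obtain ⟨g, hg⟩ := exists_embedding_of_embB hs hlt
    choose k hk using fun i => (hmem _).1 (hg i)
    have hk' : ∀ i, f (k i) = g i := fun i => Fin.ext (hk i)
    refine ⟨⟨⟨k, fun i j hij => g.injective ?_⟩, fun {i j} => ?_⟩⟩
    · rw [← hk', ← hk', hij]
    · rw [← g.map_rel_iff, ← hk', ← hk', f.map_rel_iff]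
      rfl
  have h1 := List.all_eq_true.1 h vs
    (List.mem_sublists'.2 List.filter_sublist)
  simp only [disconnB_eq_false hX f hmem, hlen, Bool.or_eq_true, decide_eq_true_eq,
    List.any_eq_true, Bool.and_eq_true, beq_iff_eq, Bool.false_eq_true, or_false] at h1
  rcases h1 with (h1 | ⟨s, hs, h1⟩) | ⟨s, hs, h2, h1⟩
  · omega
  · exact .inl ⟨s, hs, hemb s h1⟩
  · obtain ⟨g⟩ := hemb s h1
    refine .inr ⟨s, hs, ⟨(RelIso.ofSurjective g ?_).symm⟩⟩
    exact ((Fintype.bijective_iff_injective_and_card g).2 ⟨g.injective, by simpa using h2⟩).2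

end Bedrossian

namespace Bedrossian

/-- The path on `n` vertices, as adjacency lists. -/
def pathL (n : ℕ) : List (List ℕ) := (List.range n).map fun i => [i + 1]

/-- The claw, as adjacency lists. -/
def clawL : List (List ℕ) := [[1, 2, 3], [], [], []]

/-- The triangle, as adjacency lists. -/
def triangleL : List (List ℕ) := [[1, 2], [2], []]

/-- The cycle on four vertices, as adjacency lists. -/
def fourCycleL : List (List ℕ) := [[1, 3], [2], [3], []]

/-- Two triangles sharing a vertex, as adjacency lists. -/
def bowtieL : List (List ℕ) := [[1, 2, 3, 4], [2], [], [4], []]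

/-- A triangle with pendant paths of length two at two of its vertices, as adjacency lists. -/
def triangleTwoPathsL : List (List ℕ) := [[1, 2, 3], [2, 4], [], [5], [6], [], []]

/-- The graphs `P₄`, `P₅`, `P₆`, `C₃`, `Z₁`, `Z₂`, `B`, `N`, `W`, as adjacency lists. -/
def bedrossianL : List (List (List ℕ)) :=
  [pathL 4, pathL 5, pathL 6, triangleL,
    [[1, 2], [2], [3], []],
    [[1, 2], [2], [3], [4], []],
    [[1, 2, 3], [2, 4], [], [], []],
    [[1, 2, 3], [2, 4], [5], [], [], []],
    [[1, 2, 3], [2, 4], [], [], [5], []]]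

/-- The complete bipartite graph `K_{2,3}`, as adjacency lists. -/
def K23 : List (List ℕ) := [[2, 3, 4], [2, 3, 4], [], [], []]

/-- The complete tripartite graph `K_{1,1,3}`, as adjacency lists. -/
def K113 : List (List ℕ) := [[1, 2, 3, 4], [2, 3, 4], [], [], []]

/-- Three internally disjoint paths of lengths 2, 3 and 3 between two vertices, as adjacency
lists. -/
def thetaL : List (List ℕ) := [[2, 3, 5], [2, 4, 6], [], [4], [], [6], []]

/-- Two triangles whose corresponding vertices are joined by edges, with a further common neighbour
for both ends of each of these edges, as adjacency lists. -/
def cappedPrismL : List (List ℕ) :=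
  [[1, 2, 3, 6], [2, 4, 7], [5, 8], [4, 5, 6], [5, 7], [8], [], [], []]

/-- Two triangles whose corresponding vertices are joined by paths of length two, as adjacency
lists. -/
def longPrismL : List (List ℕ) :=
  [[1, 2, 6], [2, 7], [8], [4, 5, 6], [5, 7], [8], [], [], []]

theorem embedding_or_embedding {α β : Type*} {R : SimpleGraph α} {S : SimpleGraph β}
    (h : ∀ (V : Type) [Fintype V] [DecidableEq V] (G : SimpleGraph V),
      TwoConnected G → IndFree G R → IndFree G S → G.IsHamiltonian)
    {r : List (List ℕ)} (h1 : twoConnB r = true) (h2 : hamB r = false) (h3 : 3 ≤ r.length) :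
    Nonempty (R ↪g listGraph r) ∨ Nonempty (S ↪g listGraph r) := by
  by_contra! hc
  refine not_isHamiltonian_of_hamB h2 (by omega)
    (h _ _ (twoConnected_of_twoConnB h1 h3) ?_ ?_) <;> simp [indFree_iff, hc]

theorem nonempty_iso_listGraph {r : List (List ℕ)} {n : ℕ} {G : SimpleGraph (Fin n)}
    (hn : r.length = n) (h : ∀ i j : Fin n, G.Adj i j ↔ adjB r i j = true) :
    Nonempty (listGraph r ≃g G) := by
  subst hn
  exact ⟨⟨Equiv.refl _, fun {i j} => h i j⟩⟩

theorem nonempty_iso_clawGraph : Nonempty (listGraph clawL ≃g clawGraph) := by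
  refine nonempty_iso_listGraph rfl ?_
  simp only [clawGraph, SimpleGraph.fromEdgeSet_adj, Set.mem_insert_iff, Set.mem_singleton_iff]
  decide

theorem nonempty_iso_pathGraph_three :
    Nonempty (listGraph (pathL 3) ≃g SimpleGraph.pathGraph 3) := by
  refine nonempty_iso_listGraph rfl ?_
  simp only [SimpleGraph.pathGraph_adj]
  decide

theorem isOneOfBedrossian_of_mem {s : List (List ℕ)} (hs : s ∈ bedrossianL) :
    IsOneOfBedrossian (listGraph s) := by
  simp only [bedrossianL, List.mem_cons, List.not_mem_nil, or_false] at hs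
  unfold IsOneOfBedrossian
  refine hs.imp ?_ (.imp ?_ (.imp ?_ (.imp ?_ (.imp ?_ (.imp ?_ (.imp ?_ (.imp ?_ ?_))))))) <;>
  · rintro rfl
    refine nonempty_iso_listGraph rfl ?_
    simp only [SimpleGraph.pathGraph_adj, triangleGraph, Z1, Z2, bullGraph, netGraph,
      woundedGraph, SimpleGraph.fromEdgeSet_adj, Set.mem_insert_iff, Set.mem_singleton_iff]
    decide

theorem _root_.IsOneOfBedrossian.of_iso {χ ξ : Type*} {X : SimpleGraph χ} {Y : SimpleGraph ξ}
    (h : IsOneOfBedrossian Y) (f : X ≃g Y) : IsOneOfBedrossian X := by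
  unfold IsOneOfBedrossian at h ⊢
  refine h.imp ?_ (.imp ?_ (.imp ?_ (.imp ?_ (.imp ?_ (.imp ?_ (.imp ?_ (.imp ?_ ?_))))))) <;>
    exact Nonempty.map f.trans

section

variable {V : Type*} {X : SimpleGraph V}

theorem not_nonempty_embedding {s r : List (List ℕ)}
    (h : embB s r (List.range r.length) = false) (hX : Nonempty (X ↪g listGraph r)) :
    ¬ Nonempty (listGraph s ↪g X) := by
  rintro ⟨f⟩
  obtain ⟨g⟩ := hX
  simp [embB_of_embedding (g.comp f)] at h

variable [Fintype V]

theorem nonempty_iso_clawGraph_of_embedding (hX : X.Connected) (hc : 3 ≤ Fintype.card V)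
    (hP : ¬ Nonempty (X ≃g SimpleGraph.pathGraph 3)) {r r' s : List (List ℕ)}
    (hr : classifyB r [s] [pathL 3, clawL] = true)
    (hr' : embB s r' (List.range r'.length) = false)
    (h : Nonempty (X ↪g listGraph r)) (h' : Nonempty (X ↪g listGraph r')) :
    Nonempty (X ≃g clawGraph) := by
  rcases exists_embedding_or_iso hr hX hc h with ⟨t, ht, hf⟩ | ⟨t, ht, ⟨f⟩⟩
  · obtain rfl := List.mem_singleton.1 ht
    exact (not_nonempty_embedding hr' h' hf).elim
  · simp only [List.mem_cons, List.not_mem_nil, or_false] at ht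
    rcases ht with rfl | rfl
    · exact (hP (nonempty_iso_pathGraph_three.map f.trans)).elim
    · exact nonempty_iso_clawGraph.map f.trans

theorem isOneOfBedrossian_of_embedding (hX : X.Connected) (hc : 3 ≤ Fintype.card V)
    (hP : ¬ Nonempty (X ≃g SimpleGraph.pathGraph 3)) (h : Nonempty (X ↪g listGraph cappedPrismL))
    (h' : Nonempty (X ↪g listGraph longPrismL)) : IsOneOfBedrossian X := by
  have hr : classifyB cappedPrismL [fourCycleL, bowtieL, triangleTwoPathsL]
      (pathL 3 :: bedrossianL) = true := by decide +kernel
  rcases exists_embedding_or_iso hr hX hc h with ⟨t, ht, hf⟩ | ⟨t, ht, ⟨f⟩⟩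
  · have hr' : ∀ t ∈ [fourCycleL, bowtieL, triangleTwoPathsL],
        embB t longPrismL (List.range longPrismL.length) = false := by decide +kernel
    exact (not_nonempty_embedding (hr' t ht) h' hf).elim
  · rcases List.mem_cons.1 ht with rfl | ht
    · exact (hP (nonempty_iso_pathGraph_three.map f.trans)).elim
    · exact (isOneOfBedrossian_of_mem ht).of_iso f

end

section

variable {α β : Type*} [Fintype β] {R : SimpleGraph α} {S : SimpleGraph β}

theorem nonempty_iso_clawGraph_or [Fintype α] (hRconn : R.Connected) (hSconn : S.Connected)
    (hRcard : 3 ≤ Fintype.card α) (hScard : 3 ≤ Fintype.card β)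
    (hRP3 : ¬ Nonempty (R ≃g SimpleGraph.pathGraph 3))
    (hSP3 : ¬ Nonempty (S ≃g SimpleGraph.pathGraph 3))
    (h : ∀ (V : Type) [Fintype V] [DecidableEq V] (G : SimpleGraph V),
      TwoConnected G → IndFree G R → IndFree G S → G.IsHamiltonian) :
    Nonempty (R ≃g clawGraph) ∨ Nonempty (S ≃g clawGraph) := by
  have h1 := embedding_or_embedding h (r := K23) (by decide +kernel) (by decide +kernel)
    (by decide)
  have h2 := embedding_or_embedding h (r := K113) (by decide +kernel) (by decide +kernel)
    (by decide)
  have h3 := embedding_or_embedding h (r := thetaL) (by decide +kernel) (by decide +kernel)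
    (by decide)
  have hK23 : classifyB K23 [fourCycleL] [pathL 3, clawL] = true := by decide +kernel
  have hK113 : classifyB K113 [triangleL] [pathL 3, clawL] = true := by decide +kernel
  have hC4 : embB fourCycleL thetaL (List.range thetaL.length) = false := by decide +kernel
  have hC3 : embB triangleL thetaL (List.range thetaL.length) = false := by decide +kernel
  have hC3' : embB triangleL K23 (List.range K23.length) = false := by decide +kernel
  have hR {r r' s} := nonempty_iso_clawGraph_of_embedding hRconn hRcard hRP3
    (r := r) (r' := r') (s := s)
  have hS {r r' s} := nonempty_iso_clawGraph_of_embedding hSconn hScard hSP3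
    (r := r) (r' := r') (s := s)
  rcases h1 with h1 | h1 <;> rcases h2 with h2 | h2 <;> rcases h3 with h3 | h3
  · exact .inl (hR hK113 hC3' h2 h1)
  · exact .inl (hR hK113 hC3' h2 h1)
  · exact .inl (hR hK23 hC4 h1 h3)
  · exact .inr (hS hK113 hC3 h2 h3)
  · exact .inl (hR hK113 hC3 h2 h3)
  · exact .inr (hS hK23 hC4 h1 h3)
  · exact .inr (hS hK113 hC3' h2 h1)
  · exact .inr (hS hK113 hC3' h2 h1)

theorem isOneOfBedrossian_of_iso_clawGraph (hSconn : S.Connected) (hScard : 3 ≤ Fintype.card β)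
    (hSP3 : ¬ Nonempty (S ≃g SimpleGraph.pathGraph 3)) (hR : Nonempty (R ≃g clawGraph))
    (h : ∀ (V : Type) [Fintype V] [DecidableEq V] (G : SimpleGraph V),
      TwoConnected G → IndFree G R → IndFree G S → G.IsHamiltonian) :
    IsOneOfBedrossian S := by
  have hc : Nonempty (listGraph clawL ↪g R) := by
    obtain ⟨f⟩ := hR
    exact nonempty_iso_clawGraph.map fun g => SimpleGraph.Iso.toEmbedding (g.trans f.symm)
  have key {r : List (List ℕ)} (h1 : twoConnB r = true) (h2 : hamB r = false)
      (h3 : 3 ≤ r.length) (h4 : embB clawL r (List.range r.length) = false) :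
      Nonempty (S ↪g listGraph r) :=
    (embedding_or_embedding h h1 h2 h3).resolve_left fun hf => not_nonempty_embedding h4 hf hc
  exact isOneOfBedrossian_of_embedding hSconn hScard hSP3
    (key (by decide +kernel) (by decide +kernel) (by decide) (by decide +kernel))
    (key (by decide +kernel) (by decide +kernel) (by decide) (by decide +kernel))

end

end Bedrossian

/-- Bedrossian's characterization: for connected graphs `R, S` of order at least 3, none
isomorphic to `P₃`, every 2-connected `R`-free and `S`-free graph is hamiltonian if and
only if, up to symmetry, `R ≅ K_{1,3}` and `S` is one of
`P₄, P₅, P₆, C₃, Z₁, Z₂, B, N, W`. -/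
theorem stmt_12 {α β : Type*} [Fintype α] [Fintype β]
    (R : SimpleGraph α) (S : SimpleGraph β)
    (hRconn : R.Connected) (hSconn : S.Connected)
    (hRcard : 3 ≤ Fintype.card α) (hScard : 3 ≤ Fintype.card β)
    (hRP3 : ¬ Nonempty (R ≃g SimpleGraph.pathGraph 3))
    (hSP3 : ¬ Nonempty (S ≃g SimpleGraph.pathGraph 3)) :
    (∀ (V : Type) [Fintype V] [DecidableEq V] (G : SimpleGraph V),
        TwoConnected G → IndFree G R → IndFree G S → G.IsHamiltonian)
    ↔ ((Nonempty (R ≃g clawGraph) ∧ IsOneOfBedrossian S) ∨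
       (Nonempty (S ≃g clawGraph) ∧ IsOneOfBedrossian R)) := by
  constructor
  · intro h
    have h' : ∀ (V : Type) [Fintype V] [DecidableEq V] (G : SimpleGraph V),
        TwoConnected G → IndFree G S → IndFree G R → G.IsHamiltonian :=
      fun V _ _ G hG hS hR => h V G hG hR hS
    rcases Bedrossian.nonempty_iso_clawGraph_or hRconn hSconn hRcard hScard hRP3 hSP3 h with
      hR | hS
    · exact .inl ⟨hR, Bedrossian.isOneOfBedrossian_of_iso_clawGraph hSconn hScard hSP3 hR h⟩
    · exact .inr ⟨hS, Bedrossian.isOneOfBedrossian_of_iso_clawGraph hRconn hRcard hRP3 hS h'⟩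
  · rintro (⟨hc, hb⟩ | ⟨hc, hb⟩) V _ _ G hG hR hS
    · exact hG.isHamiltonian hR hS hc hb
    · exact hG.isHamiltonian hS hR hc hb
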